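/- arXiv:2108.01580 — 2 statements merged into one kernel-verified Lean document; each statement's English description precedes it below -/
import Mathlib

section
/- For every k ≥ 2 and every ε > 0 there exists a constant C = C(k, ε) with the following property. Let A_1, …, A_{k-1}, B be finite abelian groups and let F : A_1 × ⋯ × A_{k-1} → B be a multilinear map such that P_{x}(F(x) = 0) ≥ ε, the probability over a uniform random tuple x. Then there is an expression F(x) = Σ_{∅ ≠ I ⊆ {1,…,k-1}} G_I(g_I(x_I), x_{{1,…,k-1}∖I}), where for each nonempty I ⊆ {1,…,k-1} there are a finite abelian group C_I with |C_I| ≤ C, a multilinear map g_I : ∏_{i∈I} A_i → C_I, and a multilinear map G_I : C_I × ∏_{i∈{1,…,k-1}∖I} A_i → B. -/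
open scoped ComplexOrder

/-- A map of (dependent) products of abelian groups is multiadditive (multilinear over ℤ)
if it is additive in each coordinate separately. -/
def IsMultiadditive {ι : Type} [DecidableEq ι] {A : ι → Type} [∀ i, AddCommGroup (A i)]
    {B : Type} [AddCommMonoid B] (φ : (∀ i, A i) → B) : Prop :=
  ∀ (i : ι) (x : ∀ j, A j) (a b : A i),
    φ (Function.update x i (a + b)) = φ (Function.update x i a) + φ (Function.update x i b)

/-- The standard character `e(x) = exp(2πix)` of `ℝ/ℤ`. -/
noncomputable def eChar (x : AddCircle (1 : ℝ)) : ℂ := AddCircle.toCircle x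

/-- The bias of a map `A_1 × ⋯ × A_k → ℝ/ℤ`. -/
noncomputable def bias {ι : Type} [Fintype ι] [DecidableEq ι] {A : ι → Type}
    [∀ i, Fintype (A i)] (φ : (∀ i, A i) → AddCircle (1 : ℝ)) : ℂ :=
  (∑ x : ∀ i, A i, eChar (φ x)) / (Fintype.card (∀ i, A i) : ℂ)

/-- The bilinear map `m_q : ℤ/q × ℤ/q → ℝ/ℤ`, `(x, y) ↦ xy/q mod 1`. -/
noncomputable def mq (q : ℕ) (x y : ZMod q) : AddCircle (1 : ℝ) :=
  (((x.val * y.val : ℕ) : ℝ) / q : ℝ)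

/-- A multilinear map `φ : A_1 × ⋯ × A_k → ℝ/ℤ` factors through `m_q` if
`φ(x) = m_q(φ₁(x_I), φ₂(x_{I^c}))` for some `I` with `0 < |I| < k` and multilinear `φ₁, φ₂`. -/
def FactorsThroughMq {ι : Type} [Fintype ι] [DecidableEq ι] {A : ι → Type}
    [∀ i, AddCommGroup (A i)] (q : ℕ) (φ : (∀ i, A i) → AddCircle (1 : ℝ)) : Prop :=
  ∃ I : Finset ι, I.Nonempty ∧ I ≠ Finset.univ ∧
    ∃ (φ₁ : (∀ i : I, A i) → ZMod q) (φ₂ : (∀ i : (Iᶜ : Finset ι), A i) → ZMod q),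
      IsMultiadditive φ₁ ∧ IsMultiadditive φ₂ ∧
      ∀ x : ∀ i, A i, φ x = mq q (φ₁ (fun i => x i)) (φ₂ (fun i => x i))

set_option linter.unusedSectionVars false

namespace MultilinearKernel

open Finset Function BigOperators

section Multiadd

variable {ι : Type} [DecidableEq ι] {A : ι → Type} [∀ i, AddCommGroup (A i)]
  {B C : Type} [AddCommGroup B] [AddCommGroup C]

/-- `F` depends only on the coordinates in `I`, and is additive in each of them. -/
structure MultiaddOn (I : Finset ι) (F : (∀ i, A i) → B) : Prop where
  map_update_add : ∀ i ∈ I, ∀ (x : ∀ j, A j) (a b : A i),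
    F (update x i (a + b)) = F (update x i a) + F (update x i b)
  map_update_of_notMem : ∀ i ∉ I, ∀ (x : ∀ j, A j) (a : A i), F (update x i a) = F x

namespace MultiaddOn

variable {I J : Finset ι} {F G : (∀ i, A i) → B}

/-- The restriction of a multiadditive map to a line in a coordinate direction. -/
def updateHom (hF : MultiaddOn I F) {i : ι} (hi : i ∈ I) (x : ∀ j, A j) : A i →+ B :=
  AddMonoidHom.mk' (fun a => F (update x i a)) (hF.map_update_add i hi x)

@[simp] lemma updateHom_apply (hF : MultiaddOn I F) {i : ι} (hi : i ∈ I) (x : ∀ j, A j)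
    (a : A i) : hF.updateHom hi x a = F (update x i a) := rfl

lemma map_update_zero (hF : MultiaddOn I F) {i : ι} (hi : i ∈ I) (x : ∀ j, A j) :
    F (update x i 0) = 0 := map_zero (hF.updateHom hi x)

lemma map_update_neg (hF : MultiaddOn I F) {i : ι} (hi : i ∈ I) (x : ∀ j, A j) (a : A i) :
    F (update x i (-a)) = -F (update x i a) := map_neg (hF.updateHom hi x) a

lemma map_update_sub (hF : MultiaddOn I F) {i : ι} (hi : i ∈ I) (x : ∀ j, A j) (a b : A i) :
    F (update x i (a - b)) = F (update x i a) - F (update x i b) :=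
  map_sub (hF.updateHom hi x) a b

lemma map_update_nsmul (hF : MultiaddOn I F) {i : ι} (hi : i ∈ I) (x : ∀ j, A j) (n : ℕ)
    (a : A i) : F (update x i (n • a)) = n • F (update x i a) :=
  map_nsmul (hF.updateHom hi x) n a

lemma map_update_sum (hF : MultiaddOn I F) {i : ι} (hi : i ∈ I) (x : ∀ j, A j) {κ : Type*}
    (s : Finset κ) (a : κ → A i) :
    F (update x i (∑ k ∈ s, a k)) = ∑ k ∈ s, F (update x i (a k)) :=
  map_sum (hF.updateHom hi x) a s

lemma map_eq_zero (hF : MultiaddOn I F) {i : ι} (hi : i ∈ I) {x : ∀ j, A j} (hx : x i = 0) :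
    F x = 0 := by
  rw [← update_eq_self i x, hx, hF.map_update_zero hi]

lemma map_update_nsmul_self (hF : MultiaddOn I F) {i : ι} (hi : i ∈ I) (x : ∀ j, A j) (n : ℕ) :
    F (update x i (n • x i)) = n • F x := by
  rw [hF.map_update_nsmul hi, update_eq_self]

lemma congr [Fintype ι] (hF : MultiaddOn I F) {x y : ∀ j, A j} (h : ∀ i ∈ I, x i = y i) :
    F x = F y := by
  have key : ∀ S : Finset ι, Disjoint S I → F (S.piecewise x y) = F y := by
    intro S
    induction S using Finset.induction_on with
    | empty => simp
    | insert i S hi ih =>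
      intro hS
      rw [Finset.disjoint_insert_left] at hS
      rw [Finset.piecewise_insert, hF.map_update_of_notMem i hS.1, ih hS.2]
  rw [← key Iᶜ (disjoint_compl_left)]
  congr 1
  ext i
  by_cases hi : i ∈ I
  · simp [hi, h i hi]
  · simp [hi]

lemma piecewise_left (hF : MultiaddOn I F) (S : Finset ι) (y : ∀ j, A j) :
    MultiaddOn (I ∩ S) (fun x => F (S.piecewise x y)) where
  map_update_add i hi x a b := by
    simp only [mem_inter] at hi
    simp only [← Finset.update_piecewise_of_mem _ _ _ hi.2]
    exact hF.map_update_add i hi.1 _ a b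
  map_update_of_notMem i hi x a := by
    by_cases h : i ∈ S
    · simp only [← Finset.update_piecewise_of_mem _ _ _ h]
      exact hF.map_update_of_notMem i (fun h' => hi (mem_inter.2 ⟨h', h⟩)) _ _
    · congr 1
      ext j
      by_cases hj : j ∈ S
      · simp [hj, ne_of_mem_of_not_mem hj h]
      · simp [hj]

lemma piecewise_right (hF : MultiaddOn I F) (S : Finset ι) (y : ∀ j, A j) :
    MultiaddOn (I \ S) (fun x => F (S.piecewise y x)) where
  map_update_add i hi x a b := by
    simp only [mem_sdiff] at hi
    simp only [← Finset.update_piecewise_of_notMem _ _ _ hi.2]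
    exact hF.map_update_add i hi.1 _ a b
  map_update_of_notMem i hi x a := by
    by_cases h : i ∈ S
    · congr 1
      ext j
      by_cases hj : j ∈ S
      · simp [hj]
      · simp [hj, (ne_of_mem_of_not_mem h hj).symm]
    · simp only [← Finset.update_piecewise_of_notMem _ _ _ h]
      exact hF.map_update_of_notMem i (fun h' => hi (mem_sdiff.2 ⟨h', h⟩)) _ _

lemma update_const (hF : MultiaddOn I F) (i : ι) (a : A i) :
    MultiaddOn (I.erase i) (fun x => F (update x i a)) where
  map_update_add j hj x b c := by
    simp only [mem_erase] at hj
    simp only [update_comm hj.1]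
    exact hF.map_update_add j hj.2 _ b c
  map_update_of_notMem j hj x b := by
    by_cases h : j = i
    · subst h
      simp
    · simp only [update_comm h]
      exact hF.map_update_of_notMem j (fun h' => hj (mem_erase.2 ⟨h, h'⟩)) _ _

lemma add (hF : MultiaddOn I F) (hG : MultiaddOn I G) : MultiaddOn I (fun x => F x + G x) where
  map_update_add i hi x a b := by
    simp only [hF.map_update_add i hi, hG.map_update_add i hi]
    abel
  map_update_of_notMem i hi x a := by
    simp only [hF.map_update_of_notMem i hi, hG.map_update_of_notMem i hi]

lemma comp_hom (hF : MultiaddOn I F) (f : B →+ C) : MultiaddOn I (fun x => f (F x)) where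
  map_update_add i hi x a b := by simp only [hF.map_update_add i hi, map_add]
  map_update_of_notMem i hi x a := by simp only [hF.map_update_of_notMem i hi]

lemma sub (hF : MultiaddOn I F) (hG : MultiaddOn I G) : MultiaddOn I (fun x => F x - G x) := by
  simpa [sub_eq_add_neg] using hF.add (hG.comp_hom (-AddMonoidHom.id B))

lemma zero : MultiaddOn I (fun _ : ∀ i, A i => (0 : B)) where
  map_update_add := by simp
  map_update_of_notMem := by simp

lemma sum {κ : Type*} {s : Finset κ} {F : κ → (∀ i, A i) → B} (hF : ∀ k ∈ s, MultiaddOn I (F k)) :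
    MultiaddOn I (fun x => ∑ k ∈ s, F k x) where
  map_update_add i hi x a b := by
    rw [← Finset.sum_add_distrib]
    exact Finset.sum_congr rfl fun k hk => (hF k hk).map_update_add i hi x a b
  map_update_of_notMem i hi x a :=
    Finset.sum_congr rfl fun k hk => (hF k hk).map_update_of_notMem i hi x a

lemma mul {R : Type} [CommRing R] {F G : (∀ i, A i) → R} (hF : MultiaddOn I F)
    (hG : MultiaddOn J G) (hIJ : Disjoint I J) : MultiaddOn (I ∪ J) (fun x => F x * G x) where
  map_update_add i hi x a b := by
    by_cases h : i ∈ I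
    · have hJ := Finset.disjoint_left.1 hIJ h
      simp only [hF.map_update_add i h, hG.map_update_of_notMem i hJ, add_mul]
    · have hJ : i ∈ J := (mem_union.1 hi).resolve_left h
      simp only [hG.map_update_add i hJ, hF.map_update_of_notMem i h, mul_add]
  map_update_of_notMem i hi x a := by
    simp only [mem_union, not_or] at hi
    simp only [hF.map_update_of_notMem i hi.1, hG.map_update_of_notMem i hi.2]

/-- Expanding a multiadditive map at a sum. -/
lemma map_piecewise_add (hF : MultiaddOn I F) {S : Finset ι} (hS : S ⊆ I) (b y : ∀ j, A j) :
    F (S.piecewise (b + y) y) = ∑ T ∈ S.powerset, F (T.piecewise b y) := by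
  have key : ∀ z : ∀ j, A j, (∀ i ∈ S, z i = y i) →
      F (S.piecewise (b + y) z) = ∑ T ∈ S.powerset, F (T.piecewise b z) := by
    induction S using Finset.induction_on with
    | empty => simp
    | insert i S hi ih =>
      intro z hz
      rw [Finset.insert_subset_iff] at hS
      rw [Finset.sum_powerset_insert hi, Finset.piecewise_insert, Pi.add_apply,
        hF.map_update_add i hS.1, add_comm]
      congr 1
      · rw [← ih hS.2 z fun j hj => hz j (mem_insert_of_mem hj)]
        congr 1
        rw [update_eq_iff]
        simp [hi, hz i (mem_insert_self _ _)]
      · rw [Finset.update_piecewise_of_notMem _ _ _ hi, ih hS.2]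
        · refine Finset.sum_congr rfl fun T hT => ?_
          have hT' : i ∉ T := fun h => hi (mem_powerset.1 hT h)
          rw [Finset.piecewise_insert, Finset.update_piecewise_of_notMem _ _ _ hT']
        · intro j hj
          rw [update_of_ne (ne_of_mem_of_not_mem hj hi)]
          exact hz j (mem_insert_of_mem hj)
  exact key y fun _ _ => rfl

end MultiaddOn

end Multiadd

section Average

variable {ι : Type} [DecidableEq ι] [Fintype ι] {A : ι → Type} [∀ i, AddCommGroup (A i)]
  [∀ i, Fintype (A i)]

lemma expect_update {M : Type*} [AddCommMonoid M] [Module ℚ≥0 M] (i : ι) (f : (∀ j, A j) → M) :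
    𝔼 x, 𝔼 a : A i, f (update x i a) = 𝔼 x, f x := by
  have hinv : Involutive (fun q : (∀ j, A j) × A i => (update q.1 i q.2, q.1 i)) := by
    rintro ⟨x, a⟩
    simp
  calc 𝔼 x, 𝔼 a : A i, f (update x i a)
      = 𝔼 q : (∀ j, A j) × A i, f (update q.1 i q.2) := by
        rw [← univ_product_univ, expect_product]
    _ = 𝔼 q : (∀ j, A j) × A i, f q.1 :=
        Fintype.expect_bijective _ hinv.bijective _ _ fun _ => rfl
    _ = 𝔼 x, f x := by
        rw [← univ_product_univ, expect_product]
        exact expect_congr rfl fun x _ => Fintype.expect_const (f x)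

lemma expect_comp_of_surjective {G H : Type*} [AddGroup G] [AddGroup H] [Fintype G] [Fintype H]
    {M : Type*} [AddCommMonoid M] [Module ℚ≥0 M] (π : G →+ H) (hπ : Surjective π) (f : H → M) :
    𝔼 x, f (π x) = 𝔼 y, f y := by
  have h1 : ∀ y, 𝔼 x, f (π x + y) = 𝔼 x, f (π x) := by
    intro y
    obtain ⟨z, rfl⟩ := hπ y
    exact Fintype.expect_equiv (Equiv.addRight z) _ _ fun x => by simp
  have h2 : ∀ x, 𝔼 y, f (π x + y) = 𝔼 y, f y := fun x =>
    Fintype.expect_equiv (Equiv.addLeft (π x)) _ _ fun y => by simp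
  calc 𝔼 x, f (π x) = 𝔼 y, 𝔼 x, f (π x + y) := by
        simp only [h1]
        exact (expect_const univ_nonempty _).symm
    _ = 𝔼 x, 𝔼 y, f (π x + y) := expect_comm _ _ _
    _ = 𝔼 y, f y := by
        simp only [h2]
        exact expect_const univ_nonempty _

lemma expect_expect_sub {G : Type*} [AddCommGroup G] [Fintype G]
    {M : Type*} [AddCommMonoid M] [Module ℚ≥0 M] (f : G → M) :
    𝔼 a, 𝔼 b, f (a - b) = 𝔼 a, f a := by
  have h : ∀ a, 𝔼 b, f (a - b) = 𝔼 b, f b := fun a =>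
    Fintype.expect_equiv (Equiv.subLeft a) _ _ fun y => by simp
  simp only [h]
  exact expect_const univ_nonempty _

open Classical in
/-- The density of the zero set of a function. -/
noncomputable def zeroDens {X B : Type*} [Fintype X] [Zero B] (F : X → B) : ℝ :=
  𝔼 x, if F x = 0 then 1 else 0

lemma zeroDens_nonneg {X B : Type*} [Fintype X] [Zero B] (F : X → B) : 0 ≤ zeroDens F :=
  expect_nonneg fun x _ => by split_ifs <;> norm_num

lemma zeroDens_mono {X B C : Type*} [Fintype X] [Zero B] [Zero C] {F : X → B} {G : X → C}
    (h : ∀ x, F x = 0 → G x = 0) : zeroDens F ≤ zeroDens G :=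
  expect_le_expect fun x _ => by
    by_cases hx : F x = 0
    · simp [hx, h x hx]
    · simp only [hx, if_false]
      split_ifs <;> norm_num

lemma zeroDens_le_one {X B : Type*} [Fintype X] [Nonempty X] [Zero B] (F : X → B) :
    zeroDens F ≤ 1 :=
  expect_le univ_nonempty fun x _ => by split_ifs <;> norm_num

lemma zeroDens_eq_one {X B : Type*} [Fintype X] [Nonempty X] [Zero B] {F : X → B}
    (h : ∀ x, F x = 0) : zeroDens F = 1 := by
  simp [zeroDens, h, expect_const]

open Classical in
lemma zeroDens_comp_of_surjective {G H : Type*} [AddCommGroup G] [Fintype G] [AddCommGroup H]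
    [Fintype H] {B : Type*} [Zero B] (π : G →+ H) (hπ : Surjective π) (F : H → B) :
    zeroDens (fun x => F (π x)) = zeroDens F :=
  expect_comp_of_surjective π hπ fun y => if F y = 0 then (1 : ℝ) else 0

lemma zeroDens_update {B : Type*} [Zero B] (i : ι) (F : (∀ j, A j) → B) :
    zeroDens F = 𝔼 a : A i, zeroDens fun x => F (update x i a) := by
  simp only [zeroDens]
  rw [← expect_update i, expect_comm]

open Classical in
/-- A Markov type inequality. -/
lemma half_le_expect_ite {X : Type*} [Fintype X] [Nonempty X] {u : X → ℝ} {ε : ℝ}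
    (h1 : ∀ x, u x ≤ 1) (hε : 0 ≤ ε) (h : ε ≤ 𝔼 x, u x) :
    ε / 2 ≤ 𝔼 x, if ε / 2 ≤ u x then (1 : ℝ) else 0 := by
  have h2 : 𝔼 x, u x ≤ 𝔼 x, ((if ε / 2 ≤ u x then (1 : ℝ) else 0) + ε / 2) := by
    refine expect_le_expect fun x _ => ?_
    split_ifs with hx
    · linarith [h1 x]
    · linarith
  rw [expect_add_distrib, expect_const univ_nonempty] at h2
  linarith

end Average

section Character

variable {ι : Type} [DecidableEq ι] [Fintype ι] {A : ι → Type} [∀ i, AddCommGroup (A i)]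
  [∀ i, Fintype (A i)] {p : ℕ} [Fact p.Prime] {I J : Finset ι}

/-- The average of `exp (2πi g(x) / p)`. -/
noncomputable def charAvg {X : Type*} [Fintype X] (g : X → ZMod p) : ℂ :=
  𝔼 x, ZMod.stdAddChar (g x)

open Classical in
lemma expect_stdAddChar_hom {G : Type*} [AddCommGroup G] [Fintype G] (f : G →+ ZMod p) :
    𝔼 a, (ZMod.stdAddChar (f a) : ℂ) = if ∀ a, f a = 0 then 1 else 0 := by
  have := AddChar.expect_eq_ite ((ZMod.stdAddChar (N := p)).compAddMonoidHom f)
  simp only [AddChar.compAddMonoidHom_apply] at this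
  rw [this]
  congr 1
  simp only [eq_iff_iff, DFunLike.ext_iff, AddChar.compAddMonoidHom_apply, AddChar.zero_apply]
  refine forall_congr' fun a => ?_
  rw [← (ZMod.injective_stdAddChar (N := p)).eq_iff, AddChar.map_zero_eq_one]

open Classical in
lemma MultiaddOn.charAvg_eq {g : (∀ i, A i) → ZMod p} (hg : MultiaddOn I g) {i : ι} (hi : i ∈ I) :
    charAvg g = ((𝔼 x, if ∀ a, g (update x i a) = 0 then (1 : ℝ) else 0 : ℝ) : ℂ) := by
  rw [charAvg, ← expect_update i]
  rw [Complex.ofReal_expect]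
  refine expect_congr rfl fun x _ => ?_
  have := expect_stdAddChar_hom (hg.updateHom hi x)
  simp only [MultiaddOn.updateHom_apply] at this
  by_cases h : ∀ a, g (update x i a) = 0 <;> simp [this, h]

open Classical in
lemma MultiaddOn.norm_charAvg_eq {g : (∀ i, A i) → ZMod p} (hg : MultiaddOn I g) {i : ι}
    (hi : i ∈ I) : ‖charAvg g‖ = 𝔼 x, if ∀ a, g (update x i a) = 0 then (1 : ℝ) else 0 := by
  rw [hg.charAvg_eq hi, Complex.norm_real, Real.norm_of_nonneg]
  exact expect_nonneg fun x _ => by split_ifs <;> norm_num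

lemma MultiaddOn.charAvg_eq_norm {g : (∀ i, A i) → ZMod p} (hg : MultiaddOn I g)
    (hI : I.Nonempty) : charAvg g = (‖charAvg g‖ : ℂ) := by
  classical
  obtain ⟨i, hi⟩ := hI
  rw [hg.norm_charAvg_eq hi, hg.charAvg_eq hi]

lemma norm_charAvg_le_one {X : Type*} [Fintype X] [Nonempty X] (g : X → ZMod p) :
    ‖charAvg g‖ ≤ 1 :=
  (RCLike.norm_expect_le (K := ℂ)).trans <| by simp [expect_const]

end Character

section Character

variable {ι : Type} [DecidableEq ι] [Fintype ι] {A : ι → Type} [∀ i, AddCommGroup (A i)]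
  [∀ i, Fintype (A i)] {p : ℕ} [Fact p.Prime] {I J : Finset ι}

lemma expect_pow_le {X : Type*} [Fintype X] [Nonempty X] {u : X → ℝ} (hu : ∀ x, 0 ≤ u x) (n : ℕ) :
    (𝔼 x, u x) ^ n ≤ 𝔼 x, u x ^ n := by
  have := Real.pow_arith_mean_le_arith_mean_pow univ (fun _ : X => ((Fintype.card X : ℝ))⁻¹) u
    (fun _ _ => by positivity) (by simp) (fun x _ => hu x) n
  simpa only [Fintype.expect_eq_sum_div_card, inv_mul_eq_div,
    ← Finset.sum_div] using this

lemma norm_expect_sq {X : Type*} [Fintype X] (w : X → ℂ) :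
    ((‖𝔼 a, w a‖ ^ 2 : ℝ) : ℂ) = 𝔼 a, 𝔼 b, w a * starRingEnd ℂ (w b) := by
  rw [← expect_mul_expect, ← map_expect, RCLike.mul_conj]
  simp

lemma norm_expect_expect_le {X Y Z : Type*} [Fintype X] [Fintype Y] [Fintype Z]
    (w : X → Y → Z → ℂ) :
    ‖𝔼 x, 𝔼 a, 𝔼 b, w x a b‖ ≤ 𝔼 a, 𝔼 b, ‖𝔼 x, w x a b‖ := by
  have : 𝔼 x, 𝔼 a, 𝔼 b, w x a b = 𝔼 a, 𝔼 b, 𝔼 x, w x a b := by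
    rw [expect_comm]
    exact expect_congr rfl fun a _ => expect_comm _ _ _
  rw [this]
  refine (RCLike.norm_expect_le (K := ℂ)).trans <| expect_le_expect fun a _ => ?_
  exact RCLike.norm_expect_le (K := ℂ)

/-- Gowers-Cauchy-Schwarz inequality: correlation of a multiadditive phase with a product of
functions, each of which misses a coordinate, is controlled by its average. -/
lemma norm_expect_mul_prod_pow_le (hJ : J.Nonempty) {g : (∀ i, A i) → ZMod p}
    (hg : MultiaddOn J g) (f : ι → (∀ i, A i) → ℂ) (hf : ∀ i ∈ J, ∀ x, ‖f i x‖ ≤ 1)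
    (hf' : ∀ i ∈ J, ∀ x a, f i (update x i a) = f i x) :
    ‖𝔼 x, ZMod.stdAddChar (g x) * ∏ i ∈ J, f i x‖ ^ 2 ^ #J ≤ ‖charAvg g‖ := by
  classical
  have first : ∀ {K : Finset ι} {i : ι} {g : (∀ i, A i) → ZMod p} {f : ι → (∀ i, A i) → ℂ}
      (hi : i ∉ K), (∀ x, ‖f i x‖ ≤ 1) → (∀ x a, f i (update x i a) = f i x) →
      ‖𝔼 x, ZMod.stdAddChar (g x) * ∏ j ∈ cons i K hi, f j x‖ ≤
        𝔼 x, ‖𝔼 a, ZMod.stdAddChar (g (update x i a)) * ∏ j ∈ K, f j (update x i a)‖ := by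
    intro K i g f hi h1 h2
    rw [← expect_update i]
    refine (RCLike.norm_expect_le (K := ℂ)).trans <| expect_le_expect fun x _ => ?_
    have : 𝔼 a, ZMod.stdAddChar (g (update x i a)) * ∏ j ∈ cons i K hi, f j (update x i a)
        = f i x * 𝔼 a, ZMod.stdAddChar (g (update x i a)) * ∏ j ∈ K, f j (update x i a) := by
      rw [mul_expect]
      refine expect_congr rfl fun a _ => ?_
      rw [prod_cons, h2]
      ring
    rw [this, norm_mul]
    exact mul_le_of_le_one_left (norm_nonneg _) (h1 x)
  induction hJ using Finset.Nonempty.cons_induction generalizing g f with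
  | singleton i =>
    have h1 := first (g := g) (f := f) (notMem_empty i) (hf i (mem_singleton_self i))
      (hf' i (mem_singleton_self i))
    have h2 : 𝔼 x, ‖𝔼 a, ZMod.stdAddChar (g (update x i a)) * ∏ j ∈ ∅, f j (update x i a)‖
        = ‖charAvg g‖ := by
      rw [hg.norm_charAvg_eq (mem_singleton_self i)]
      refine expect_congr rfl fun x _ => ?_
      simp only [prod_empty, mul_one]
      have := expect_stdAddChar_hom (hg.updateHom (mem_singleton_self i) x)
      simp only [MultiaddOn.updateHom_apply] at this
      by_cases h : ∀ a, g (update x i a) = 0 <;> simp [this, h]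
    rw [h2] at h1
    simp only [cons_empty] at h1
    exact (pow_le_of_le_one (norm_nonneg _) (h1.trans (norm_charAvg_le_one g)) (by simp)).trans h1
  | cons i K hi hK ih =>
    have hgi : ∀ a, MultiaddOn K fun x => g (update x i a) := fun a => by
      have := hg.update_const i a
      rwa [cons_eq_insert, erase_insert hi] at this
    set w : (∀ j, A j) → A i → ℂ := fun x a =>
      ZMod.stdAddChar (g (update x i a)) * ∏ j ∈ K, f j (update x i a) with hw
    set F : A i → A i → ι → (∀ j, A j) → ℂ := fun a b j x =>
      f j (update x i a) * starRingEnd ℂ (f j (update x i b)) with hF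
    have h1 := first (g := g) (f := f) hi (hf i (mem_cons_self i K)) (hf' i (mem_cons_self i K))
    have h2 : ∀ x a b, w x a * starRingEnd ℂ (w x b) =
        ZMod.stdAddChar (g (update x i (a - b))) * ∏ j ∈ K, F a b j x := by
      intro x a b
      simp only [hw, hF, map_mul, map_prod, hg.map_update_sub (mem_cons_self i K),
        AddChar.map_sub_eq_div, prod_mul_distrib, div_eq_mul_inv, ← AddChar.map_neg_eq_inv,
        AddChar.map_neg_eq_conj]
      ring
    have h3 : ‖𝔼 x, ZMod.stdAddChar (g x) * ∏ j ∈ cons i K hi, f j x‖ ^ 2 ≤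
        𝔼 a, 𝔼 b, ‖𝔼 x, ZMod.stdAddChar (g (update x i (a - b))) * ∏ j ∈ K, F a b j x‖ := by
      calc _ ≤ (𝔼 x, ‖𝔼 a, w x a‖) ^ 2 := by gcongr
        _ ≤ 𝔼 x, ‖𝔼 a, w x a‖ ^ 2 := expect_pow_le (fun _ => norm_nonneg _) 2
        _ = ‖𝔼 x, 𝔼 a, 𝔼 b, w x a * starRingEnd ℂ (w x b)‖ := by
          simp only [← norm_expect_sq]
          rw [← Complex.ofReal_expect, Complex.norm_real, Real.norm_of_nonneg]
          exact expect_nonneg fun x _ => by positivity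
        _ ≤ _ := by
          simp only [h2]
          exact norm_expect_expect_le _
    have h4 : ∀ a b, ‖𝔼 x, ZMod.stdAddChar (g (update x i (a - b))) * ∏ j ∈ K, F a b j x‖ ^ 2 ^ #K
        ≤ ‖charAvg fun x => g (update x i (a - b))‖ := by
      intro a b
      refine ih (hgi _) (F a b) (fun j hj x => ?_) (fun j hj x c => ?_)
      · simp only [hF, norm_mul, RCLike.norm_conj]
        exact mul_le_one₀ (hf j (mem_cons_of_mem hj) _) (norm_nonneg _)
          (hf j (mem_cons_of_mem hj) _)
      · have hji : j ≠ i := ne_of_mem_of_not_mem hj hi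
        simp only [hF, update_comm hji, hf' j (mem_cons_of_mem hj)]
    have h5 : 𝔼 a : A i, ‖charAvg fun x => g (update x i a)‖ = ‖charAvg g‖ := by
      have : ((𝔼 a : A i, ‖charAvg fun x => g (update x i a)‖ : ℝ) : ℂ) = charAvg g := by
        rw [Complex.ofReal_expect]
        simp only [← fun a => (hgi a).charAvg_eq_norm hK]
        simp only [charAvg]
        rw [expect_comm]
        exact expect_update i fun x => (ZMod.stdAddChar (g x) : ℂ)
      rw [← this, Complex.norm_real, Real.norm_of_nonneg]
      exact expect_nonneg fun x _ => norm_nonneg _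
    rw [card_cons, pow_succ', pow_mul]
    calc _ ≤ (𝔼 a, 𝔼 b, ‖𝔼 x, ZMod.stdAddChar (g (update x i (a - b))) * ∏ j ∈ K, F a b j x‖)
            ^ 2 ^ #K := by gcongr
      _ ≤ 𝔼 a, (𝔼 b, ‖𝔼 x, ZMod.stdAddChar (g (update x i (a - b))) * ∏ j ∈ K, F a b j x‖)
            ^ 2 ^ #K := expect_pow_le (fun _ => expect_nonneg fun _ _ => norm_nonneg _) _
      _ ≤ 𝔼 a, 𝔼 b, ‖𝔼 x, ZMod.stdAddChar (g (update x i (a - b))) * ∏ j ∈ K, F a b j x‖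
            ^ 2 ^ #K := expect_le_expect fun a _ => expect_pow_le (fun _ => norm_nonneg _) _
      _ ≤ 𝔼 a, 𝔼 b, ‖charAvg fun x => g (update x i (a - b))‖ :=
          expect_le_expect fun a _ => expect_le_expect fun b _ => h4 a b
      _ = ‖charAvg g‖ := by
          rw [← h5]
          exact expect_expect_sub fun a => ‖charAvg fun x => g (update x i a)‖

end Character

section Equations

variable {ι : Type} {A : ι → Type} {p : ℕ}

/-- Systems of scalar equations on a product, each labelled by a set of coordinates. -/
abbrev Equations (A : ι → Type) (p : ℕ) : Type := List (Finset ι × ((∀ i, A i) → ZMod p))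

/-- Every equation is multiadditive in its nonempty set of coordinates. -/
def Equations.Proper [DecidableEq ι] [∀ i, AddCommGroup (A i)] (L : Equations A p) : Prop :=
  ∀ q ∈ L, q.1.Nonempty ∧ MultiaddOn q.1 q.2

/-- All equations hold at `x`. -/
def Equations.Holds (L : Equations A p) (x : ∀ i, A i) : Prop := ∀ q ∈ L, q.2 x = 0

end Equations

section Density

lemma inv_card_le_zeroDens {G H : Type*} [AddCommGroup G] [Fintype G] [AddCommGroup H] [Fintype H]
    (f : G →+ H) : ((Fintype.card H : ℝ))⁻¹ ≤ zeroDens f := by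
  classical
  have h1 : #(univ : Finset G) ≤ #{x | f x = 0} * #(univ.image f) := by
    refine card_le_mul_card_image _ _ fun b hb => ?_
    obtain ⟨y, -, rfl⟩ := mem_image.1 hb
    refine card_le_card_of_injOn (fun x => x - y) (fun x hx => ?_) (sub_left_injective.injOn)
    simp only [coe_filter, Set.mem_ofPred_eq, mem_univ, true_and] at hx ⊢
    rw [map_sub, hx, sub_self]
  have h2 : #(univ : Finset G) ≤ #{x | f x = 0} * Fintype.card H :=
    h1.trans (Nat.mul_le_mul_left _ (card_le_univ _))
  have h3 : zeroDens f = #{x | f x = 0} / (Fintype.card G : ℝ) := by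
    simp only [zeroDens, Fintype.expect_eq_sum_div_card, sum_boole]
  rw [h3, inv_eq_one_div, div_le_div_iff₀ (by positivity) (by positivity), one_mul]
  exact_mod_cast h2

variable {ι : Type} [DecidableEq ι] [Fintype ι] {A : ι → Type} [∀ i, AddCommGroup (A i)]
  [∀ i, Fintype (A i)] {p : ℕ} [Fact p.Prime] {I J : Finset ι}

open Classical in
lemma inv_pow_le_expect_forall {G : Type*} [AddCommGroup G] [Fintype G] (l : List (G →+ ZMod p)) :
    ((p : ℝ)⁻¹) ^ l.length ≤ 𝔼 a, if ∀ f ∈ l, f a = 0 then (1 : ℝ) else 0 := by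
  refine le_of_eq_of_le ?_ <|
    (inv_card_le_zeroDens (AddMonoidHom.pi fun n : Fin l.length => l.get n)).trans ?_
  · simp [ZMod.card]
  · refine expect_le_expect fun a _ => ?_
    by_cases h : ∀ f ∈ l, f a = 0
    · rw [if_pos h]
      split_ifs <;> norm_num
    · rw [if_neg h, if_neg]
      intro h'
      refine h fun f hf => ?_
      obtain ⟨n, rfl⟩ := List.get_of_mem hf
      exact congr_fun h' n

open Classical in
/-- A system of multiadditive equations has many solutions. -/
lemma Equations.Proper.inv_pow_le {L : Equations A p} (hL : L.Proper) :
    ((p : ℝ)⁻¹) ^ (L.length * Fintype.card ι) ≤ 𝔼 x, if L.Holds x then (1 : ℝ) else 0 := by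
  have key : ∀ S : Finset ι, ((p : ℝ)⁻¹) ^ (L.length * #S) ≤
      𝔼 x, if ∀ q ∈ L, q.1 ⊆ S → q.2 x = 0 then (1 : ℝ) else 0 := by
    intro S
    induction S using Finset.induction_on with
    | empty =>
      have : ∀ x, ∀ q ∈ L, q.1 ⊆ ∅ → q.2 x = 0 := fun x q hq h =>
        absurd (subset_empty.1 h) (hL q hq).1.ne_empty
      simp only [card_empty, mul_zero, pow_zero, if_pos (this _), Fintype.expect_const, le_refl]
    | insert i S hi ih =>
      rw [← expect_update i, card_insert_of_notMem hi, mul_add, mul_one, pow_add]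
      refine (mul_le_mul_of_nonneg_right ih (by positivity)).trans ?_
      rw [expect_mul]
      refine expect_le_expect fun x _ => ?_
      by_cases hx : ∀ q ∈ L, q.1 ⊆ S → q.2 x = 0
      · rw [if_pos hx, one_mul]
        set l : List (A i →+ ZMod p) := L.map fun q =>
          if h : i ∈ q.1 ∧ MultiaddOn q.1 q.2 then h.2.updateHom h.1 x else 0 with hl
        have h1 := inv_pow_le_expect_forall l
        rw [hl, List.length_map] at h1
        refine h1.trans (expect_le_expect fun a _ => ?_)
        by_cases ha : ∀ f ∈ l, f a = 0
        · rw [if_pos ha, if_pos]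
          intro q hq hqS
          by_cases hiq : i ∈ q.1
          · have := ha _ (List.mem_map_of_mem hq)
            rwa [dif_pos ⟨hiq, (hL q hq).2⟩] at this
          · rw [(hL q hq).2.map_update_of_notMem i hiq]
            exact hx q hq ((subset_insert_iff_of_notMem hiq).1 hqS)
        · rw [if_neg ha]
          split_ifs <;> norm_num
      · rw [if_neg hx, zero_mul]
        exact expect_nonneg fun a _ => by split_ifs <;> norm_num
  simpa [Equations.Holds] using key univ

lemma exists_or_large_charAvg {J : Finset ι} (hJ : J.Nonempty) {g₀ : (∀ i, A i) → ZMod p}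
    (hg₀ : MultiaddOn J g₀) {H : List ((∀ i, A i) → ZMod p)} (hH : ∀ h ∈ H, MultiaddOn J h)
    {W : Equations A p} (hW : W.Proper) (hWJ : ∀ q ∈ W, q.1 ⊂ J) :
    (∀ t, ∃ b, W.Holds b ∧ (∀ h ∈ H, h b = 0) ∧ g₀ b = t) ∨
    ∃ g, MultiaddOn J g ∧ (∀ x, (∀ h ∈ H, h x = 0) → g x = g₀ x) ∧
      (((p : ℝ)⁻¹) ^ ((W.length + H.length) * Fintype.card ι)) ^ 2 ^ #J ≤ ‖charAvg g‖ := by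
  classical
  by_cases hex : ∃ b, W.Holds b ∧ (∀ h ∈ H, h b = 0) ∧ g₀ b ≠ 0
  · left
    intro t
    obtain ⟨b, hb1, hb2, hb3⟩ := hex
    obtain ⟨i, hi⟩ := hJ
    set n := (t / g₀ b).val
    refine ⟨update b i (n • b i), fun q hq => ?_, fun h hh => ?_, ?_⟩
    · by_cases hiq : i ∈ q.1
      · rw [(hW q hq).2.map_update_nsmul_self hiq, hb1 q hq, smul_zero]
      · rw [(hW q hq).2.map_update_of_notMem i hiq, hb1 q hq]
    · rw [(hH h hh).map_update_nsmul_self hi, hb2 h hh, smul_zero]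
    · rw [hg₀.map_update_nsmul_self hi, nsmul_eq_mul, ZMod.natCast_val, ZMod.cast_id,
        div_mul_cancel₀ _ hb3]
  · right
    push Not at hex
    have remove : ∀ (H : List ((∀ i, A i) → ZMod p)) (hH : ∀ h ∈ H, MultiaddOn J h)
        (g : (∀ i, A i) → ZMod p) (hg : MultiaddOn J g) (δ : ℝ),
        δ ≤ ‖𝔼 x, (if W.Holds x then 1 else 0) * (if ∀ h ∈ H, h x = 0 then 1 else 0) *
          (ZMod.stdAddChar (g x) : ℂ)‖ →
        ∃ g', MultiaddOn J g' ∧ (∀ x, (∀ h ∈ H, h x = 0) → g' x = g x) ∧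
          δ ≤ ‖𝔼 x, (if W.Holds x then 1 else 0) * (ZMod.stdAddChar (g' x) : ℂ)‖ := by
      intro H
      induction H with
      | nil => exact fun _ g hg δ hδ => ⟨g, hg, fun _ _ => rfl, by simpa using hδ⟩
      | cons h H ih =>
        intro hH g hg δ hδ
        have hh : MultiaddOn J h := hH h (by simp)
        have h1 : 𝔼 x, (if W.Holds x then 1 else 0) *
            (if ∀ h' ∈ h :: H, h' x = 0 then 1 else 0) * (ZMod.stdAddChar (g x) : ℂ) =
            𝔼 c : ZMod p, 𝔼 x, (if W.Holds x then 1 else 0) *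
              (if ∀ h' ∈ H, h' x = 0 then 1 else 0) *
              (ZMod.stdAddChar (g x + c * h x) : ℂ) := by
          rw [expect_comm]
          refine expect_congr rfl fun x _ => ?_
          have h3 : (∀ a : ZMod p, a * h x = 0) ↔ h x = 0 :=
            ⟨fun H => by simpa using H 1, fun H => by simp [H]⟩
          have h2 := expect_stdAddChar_hom (AddMonoidHom.mulRight (h x) : ZMod p →+ ZMod p)
          simp only [AddMonoidHom.coe_mulRight] at h2
          simp only [AddChar.map_add_eq_mul, ← mul_expect, h2, List.forall_mem_cons, h3]
          by_cases h4 : h x = 0 <;> by_cases h5 : ∀ h' ∈ H, h' x = 0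
          all_goals simp [h4, h5]
        rw [h1] at hδ
        obtain ⟨c, -, hc⟩ := exists_le_of_le_expect univ_nonempty
          (hδ.trans (RCLike.norm_expect_le (K := ℂ)))
        obtain ⟨g', hg', hgg, hδ'⟩ := ih (fun h' hh' => hH h' (by simp [hh']))
          (fun x => g x + c * h x) (hg.add (hh.comp_hom (AddMonoidHom.mulLeft c))) δ hc
        refine ⟨g', hg', fun x hx => ?_, hδ'⟩
        simp only [List.forall_mem_cons] at hx
        rw [hgg x hx.2, hx.1, mul_zero, add_zero]
    have h1 : ((p : ℝ)⁻¹) ^ ((W.length + H.length) * Fintype.card ι) ≤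
        ‖𝔼 x, (if W.Holds x then 1 else 0) * (if ∀ h ∈ H, h x = 0 then 1 else 0) *
          (ZMod.stdAddChar (g₀ x) : ℂ)‖ := by
      have hL : Equations.Proper (W ++ H.map fun h => (J, h)) := by
        intro q hq
        rcases List.mem_append.1 hq with hq | hq
        · exact hW q hq
        · obtain ⟨h, hh, rfl⟩ := List.mem_map.1 hq
          exact ⟨hJ, hH h hh⟩
      have h2 := hL.inv_pow_le
      rw [List.length_append, List.length_map] at h2
      refine h2.trans_eq ?_
      rw [← Real.norm_of_nonneg (expect_nonneg fun x _ => by split_ifs <;> norm_num),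
        ← Complex.norm_real, Complex.ofReal_expect]
      congr 1
      refine expect_congr rfl fun x _ => ?_
      have h3 : Equations.Holds (W ++ H.map fun h => (J, h)) x ↔
          W.Holds x ∧ ∀ h ∈ H, h x = 0 := by
        simp only [Equations.Holds, List.forall_mem_append, List.forall_mem_map]
      by_cases h4 : W.Holds x <;> by_cases h5 : ∀ h ∈ H, h x = 0
      · rw [if_pos (h3.2 ⟨h4, h5⟩), if_pos h4, if_pos h5, hex x h4 h5]
        simp
      · rw [if_neg fun h => h5 (h3.1 h).2, if_neg h5]
        simp
      all_goals
        rw [if_neg fun h => h4 (h3.1 h).1, if_neg h4]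
        simp
    obtain ⟨g, hg, hgg, hδ⟩ := remove H hH g₀ hg₀ _ h1
    refine ⟨g, hg, hgg, ?_⟩
    refine (pow_le_pow_left₀ (by positivity) hδ _).trans ?_
    set f : ι → (∀ i, A i) → ℂ := fun i x => if ∀ q ∈ W, i ∉ q.1 → q.2 x = 0 then 1 else 0 with hf
    have h2 : ∀ x, (if W.Holds x then 1 else 0) * (ZMod.stdAddChar (g x) : ℂ) =
        ZMod.stdAddChar (g x) * ∏ i ∈ J, f i x := by
      intro x
      rw [mul_comm]
      congr 1
      simp only [hf]
      by_cases hx : W.Holds x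
      · rw [if_pos hx]
        exact (prod_eq_one fun i _ => if_pos fun q hq _ => hx q hq).symm
      · rw [if_neg hx]
        obtain ⟨q, hq, hqx⟩ : ∃ q ∈ W, q.2 x ≠ 0 := by
          simpa only [Equations.Holds, not_forall, exists_prop] using hx
        obtain ⟨i, hi, hiq⟩ := Finset.exists_of_ssubset (hWJ q hq)
        rw [prod_eq_zero hi]
        exact if_neg fun h => hqx (h q hq hiq)
    simp only [h2]
    refine norm_expect_mul_prod_pow_le hJ hg f (fun i _ x => ?_) (fun i _ x a => ?_)
    · simp only [hf]
      split_ifs <;> simp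
    · simp only [hf]
      congr 1
      refine propext (forall₂_congr fun q hq => forall_congr' fun hiq => ?_)
      rw [(hW q hq).2.map_update_of_notMem i hiq]

end Density

section Peeling

variable {ι : Type} [DecidableEq ι] [Fintype ι] {A : ι → Type} [∀ i, AddCommGroup (A i)]
  {p : ℕ} [Fact p.Prime] {I J₀ : Finset ι} {φ g₀ : (∀ i, A i) → ZMod p} {L : Equations A p}

/-- A form vanishing on a system of equations changes sign when the coordinates in `J₀` are
replaced by those of a suitable point `b`. -/
lemma add_piecewise_eq_zero (hJI : J₀ ⊆ I) (hJ : J₀.Nonempty) (hφ : MultiaddOn I φ)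
    (hg₀ : MultiaddOn J₀ g₀) (hL : L.Proper) (hLJ : ∀ q ∈ L, J₀ ⊆ q.1 → q.1 = J₀)
    (hφL : ∀ x, g₀ x = 0 → L.Holds x → φ x = 0) {b z : ∀ i, A i} (hz : L.Holds z)
    (hz₀ : g₀ z = 1) (hb₀ : g₀ b = -1) (hb : ∀ q ∈ L, q.1 = J₀ → q.2 b = 0)
    (hbz : ∀ q ∈ (J₀, g₀) :: L, ∀ S ⊆ J₀, (q.1 ∩ S).Nonempty → q.1 ∩ S ≠ J₀ →
      q.2 (S.piecewise b z) = 0) :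
    φ z + φ (J₀.piecewise b z) = 0 := by
  have hmid : ∀ S ⊆ J₀, S ≠ ∅ → S ≠ J₀ → φ (S.piecewise b z) = 0 := by
    intro S hS hS0 hSJ
    refine hφL _ ?_ fun q hq => ?_
    · refine hbz (J₀, g₀) (by simp) S hS ?_ ?_ <;> rw [inter_eq_right.2 hS]
      · exact nonempty_iff_ne_empty.2 hS0
      · exact hSJ
    · by_cases h : (q.1 ∩ S).Nonempty
      · refine hbz q (by simp [hq]) S hS h fun h' => hSJ ?_
        exact hS.antisymm (h' ▸ inter_subset_right)
      · rw [(hL q hq).2.congr (y := z), hz q hq]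
        intro i hi
        exact piecewise_eq_of_notMem _ _ _ fun hiS => h ⟨i, mem_inter.2 ⟨hi, hiS⟩⟩
  have hexp : ∀ q ∈ (J₀, g₀) :: L, MultiaddOn q.1 q.2 → (J₀ ⊆ q.1 → q.1 = J₀) →
      q.2 (J₀.piecewise (b + z) z) = q.2 z + if q.1 = J₀ then q.2 b else 0 := by
    intro q hq hqm hqJ
    have h1 : q.2 (J₀.piecewise (b + z) z) = q.2 ((q.1 ∩ J₀).piecewise (b + z) z) :=
      hqm.congr fun i hi => by by_cases h : i ∈ J₀ <;> simp [h, hi]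
    rw [h1, hqm.map_piecewise_add inter_subset_left, ← sum_erase_add _ _ (empty_mem_powerset _),
      piecewise_empty, add_comm]
    congr 1
    split_ifs with h
    · rw [h, inter_self, ← sum_erase_add (a := J₀)]
      · rw [sum_eq_zero, zero_add]
        · exact hqm.congr fun i hi => by simp [h ▸ hi]
        · intro S hS
          simp only [mem_erase, mem_powerset] at hS
          have h2 : q.1 ∩ S = S := by rw [h, inter_eq_right.2 hS.2.2]
          exact hbz q hq S hS.2.2 (by rw [h2]; exact nonempty_iff_ne_empty.2 hS.2.1)
            (by rw [h2]; exact hS.1)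
      · simpa using hJ.ne_empty
    · refine sum_eq_zero fun S hS => ?_
      simp only [mem_erase, mem_powerset, subset_inter_iff] at hS
      have h2 : q.1 ∩ S = S := inter_eq_right.2 hS.2.1
      refine hbz q hq S hS.2.2 (by rw [h2]; exact nonempty_iff_ne_empty.2 hS.1) ?_
      rw [h2]
      rintro rfl
      exact h (hqJ hS.2.1)
  have hlast : φ (J₀.piecewise (b + z) z) = 0 := by
    refine hφL _ ?_ fun q hq => ?_
    · have := hexp (J₀, g₀) (by simp) hg₀ fun _ => rfl
      simpa [hz₀, hb₀] using this
    · rw [hexp q (by simp [hq]) (hL q hq).2 (hLJ q hq), hz q hq, zero_add]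
      split_ifs with h
      · exact hb q hq h
      · rfl
  rw [hφ.map_piecewise_add hJI, ← sum_erase_add _ _ (empty_mem_powerset _), piecewise_empty,
    ← sum_erase_add (a := J₀), sum_eq_zero, zero_add, add_comm] at hlast
  · exact hlast
  · intro S hS
    simp only [mem_erase, mem_powerset] at hS
    exact hmid S hS.2.2 hS.2.1 hS.1
  · simpa using hJ.ne_empty

/-- A form that vanishes on `g₀ = 0` and a system of equations is a product on the solution set of
an enlarged system from which `g₀` has been removed. -/
lemma eq_mul_of_exists (hJI : J₀ ⊆ I) (hJ : J₀.Nonempty) (hφ : MultiaddOn I φ)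
    (hg₀ : MultiaddOn J₀ g₀) (hL : L.Proper) (hLJ : ∀ q ∈ L, J₀ ⊆ q.1 → q.1 = J₀)
    (hφL : ∀ x, g₀ x = 0 → L.Holds x → φ x = 0) {a : ∀ i, A i} (ha₀ : g₀ a = 1)
    (ha : ∀ q ∈ L, q.1 ⊆ J₀ → q.2 a = 0)
    (hex : ∀ z z' : ∀ i, A i, ∃ b, g₀ b = -1 ∧ (∀ q ∈ L, q.1 = J₀ → q.2 b = 0) ∧
      ∀ q ∈ (J₀, g₀) :: L, ∀ S ⊆ J₀, (q.1 ∩ S).Nonempty → q.1 ∩ S ≠ J₀ →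
        q.2 (S.piecewise b z) = 0 ∧ q.2 (S.piecewise b z') = 0)
    {x : ∀ i, A i} (hx : L.Holds x)
    (hxa : ∀ q ∈ L, (q.1 ∩ J₀).Nonempty → ¬ q.1 ⊆ J₀ → q.2 (J₀.piecewise a x) = 0) :
    φ x = g₀ x * φ (J₀.piecewise a x) := by
  by_cases hgx : g₀ x = 0
  · rw [hφL x hgx hx, hgx, zero_mul]
  obtain ⟨i₀, hi₀⟩ := hJ
  set n := ((g₀ x)⁻¹).val
  have hn : (n : ZMod p) = (g₀ x)⁻¹ := by rw [ZMod.natCast_val, ZMod.cast_id]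
  set y := update x i₀ (n • x i₀) with hy
  have hyL : L.Holds y := by
    intro q hq
    by_cases hiq : i₀ ∈ q.1
    · rw [hy, (hL q hq).2.map_update_nsmul_self hiq, hx q hq, smul_zero]
    · rw [hy, (hL q hq).2.map_update_of_notMem _ hiq, hx q hq]
  have hy₀ : g₀ y = 1 := by
    rw [hy, hg₀.map_update_nsmul_self hi₀, nsmul_eq_mul, hn, inv_mul_cancel₀ hgx]
  have hyφ : φ y = (g₀ x)⁻¹ * φ x := by
    rw [hy, hφ.map_update_nsmul_self (hJI hi₀), nsmul_eq_mul, hn]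
  have hay : J₀.piecewise a y = J₀.piecewise a x := by
    ext i
    by_cases hi : i ∈ J₀
    · simp [hi]
    · simp [hi, hy, (ne_of_mem_of_not_mem hi₀ hi).symm]
  set a' := J₀.piecewise a x with ha'
  have haL : L.Holds a' := by
    intro q hq
    by_cases h1 : q.1 ⊆ J₀
    · rw [(hL q hq).2.congr (y := a), ha q hq h1]
      exact fun i hi => by simp [ha', h1 hi]
    · by_cases h2 : (q.1 ∩ J₀).Nonempty
      · exact hxa q hq h2 h1
      · rw [(hL q hq).2.congr (y := x), hx q hq]
        exact fun i hi => piecewise_eq_of_notMem _ _ _ fun hiS => h2 ⟨i, mem_inter.2 ⟨hi, hiS⟩⟩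
  have ha'₀ : g₀ a' = 1 := by
    rw [hg₀.congr (y := a), ha₀]
    exact fun i hi => by simp [ha', hi]
  obtain ⟨b, hb₀, hb, hbz⟩ := hex y a'
  have h1 := add_piecewise_eq_zero hJI ⟨i₀, hi₀⟩ hφ hg₀ hL hLJ hφL hyL hy₀ hb₀ hb
    fun q hq S hS h h' => (hbz q hq S hS h h').1
  have h2 := add_piecewise_eq_zero hJI ⟨i₀, hi₀⟩ hφ hg₀ hL hLJ hφL haL ha'₀ hb₀ hb
    fun q hq S hS h h' => (hbz q hq S hS h h').2
  have h3 : J₀.piecewise b a' = J₀.piecewise b y := by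
    rw [← hay]
    ext i
    by_cases hi : i ∈ J₀ <;> simp [hi]
  rw [h3] at h2
  have h4 : φ y = φ a' := add_right_cancel (h1.trans h2.symm)
  rw [← h4, hyφ, mul_inv_cancel_left₀ hgx]

end Peeling

section Decomposition

variable {ι : Type} [DecidableEq ι] [Fintype ι] {A : ι → Type} [∀ i, AddCommGroup (A i)]
  {p : ℕ} {I : Finset ι}

/-- `φ` is a sum of at most `N` products of forms in complementary proper subsets of `I`. -/
def Decomposable (I : Finset ι) (N : ℕ) (φ : (∀ i, A i) → ZMod p) : Prop :=
  ∃ T : List (Finset ι × ((∀ i, A i) → ZMod p) × ((∀ i, A i) → ZMod p)), T.length ≤ N ∧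
    (∀ t ∈ T, t.1.Nonempty ∧ t.1 ⊂ I ∧ MultiaddOn t.1 t.2.1 ∧ MultiaddOn (I \ t.1) t.2.2) ∧
    ∀ x, φ x = (T.map fun t => t.2.1 x * t.2.2 x).sum

lemma Decomposable.mono {N N' : ℕ} {φ : (∀ i, A i) → ZMod p} (h : Decomposable I N φ)
    (hN : N ≤ N') : Decomposable I N' φ := by
  obtain ⟨T, h1, h2⟩ := h
  exact ⟨T, h1.trans hN, h2⟩

lemma Decomposable.of_eq_zero {N : ℕ} {φ : (∀ i, A i) → ZMod p} (h : ∀ x, φ x = 0) :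
    Decomposable I N φ := ⟨[], by simp, by simp, by simpa using h⟩

lemma Decomposable.of_sub_mul {N : ℕ} {φ a b : (∀ i, A i) → ZMod p} {J : Finset ι}
    (h : Decomposable I N fun x => φ x - a x * b x) (hJ : J.Nonempty) (hJI : J ⊂ I)
    (ha : MultiaddOn J a) (hb : MultiaddOn (I \ J) b) : Decomposable I (N + 1) φ := by
  obtain ⟨T, h1, h2, h3⟩ := h
  refine ⟨(J, a, b) :: T, by simpa using h1, ?_, fun x => ?_⟩
  · simp only [List.forall_mem_cons]
    exact ⟨⟨hJ, hJI, ha, hb⟩, h2⟩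
  · rw [List.map_cons, List.sum_cons, ← h3, add_sub_cancel]

variable (ι p) in
/-- Forms of degree `k` with large average are decomposable. -/
def StructureTheorem [Fact p.Prime] (k : ℕ) : Prop :=
  ∀ η : ℝ, 0 < η → ∃ N : ℕ, ∀ (A : ι → Type) [∀ i, AddCommGroup (A i)] [∀ i, Fintype (A i)]
    (I : Finset ι) (φ : (∀ i, A i) → ZMod p), #I = k → MultiaddOn I φ → η ≤ ‖charAvg φ‖ →
    Decomposable I N φ

variable (ι p) in
/-- Forms of degree `k` that vanish on the solutions of at most `d` equations of degree `m`
and `L` equations of smaller degree are decomposable into `N` terms. -/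
def VanishingTheorem (k m d L N : ℕ) : Prop :=
  ∀ (A : ι → Type) [∀ i, AddCommGroup (A i)] [∀ i, Fintype (A i)] (I : Finset ι)
    (φ : (∀ i, A i) → ZMod p) (T W : Equations A p), #I = k → MultiaddOn I φ → T.Proper →
    W.Proper → (∀ q ∈ T, q.1 ⊆ I ∧ #q.1 = m) → (∀ q ∈ W, q.1 ⊆ I ∧ #q.1 < m) →
    T.length ≤ d → W.length ≤ L → (∀ x, T.Holds x → W.Holds x → φ x = 0) → Decomposable I N φ

lemma Equations.Proper.append {L M : Equations A p} (hL : L.Proper) (hM : M.Proper) :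
    Equations.Proper (L ++ M) := fun q hq => (List.mem_append.1 hq).elim (hL q) (hM q)

lemma Equations.holds_append {L M : Equations A p} {x : ∀ i, A i} :
    Equations.Holds (L ++ M) x ↔ L.Holds x ∧ M.Holds x := List.forall_mem_append

/-- The equations `q (S.piecewise b z) = 0` in the unknown `b`, for all `S ⊆ J₀` such that the
unknown enters in a nonempty proper subset of `J₀`. -/
noncomputable def Equations.slices (L : Equations A p) (J₀ : Finset ι) (z : ∀ i, A i) :
    Equations A p :=
  L.flatMap fun q => ({S ∈ J₀.powerset | (q.1 ∩ S).Nonempty ∧ q.1 ∩ S ≠ J₀} : Finset _).toList.map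
    fun S => (q.1 ∩ S, fun b => q.2 (S.piecewise b z))

lemma Equations.length_slices_le (L : Equations A p) (J₀ : Finset ι) (z : ∀ i, A i) :
    (L.slices J₀ z).length ≤ L.length * 2 ^ Fintype.card ι := by
  rw [slices, List.length_flatMap]
  refine (List.sum_le_card_nsmul _ (2 ^ Fintype.card ι) ?_).trans_eq (by simp)
  simp only [List.mem_map, forall_exists_index, and_imp, forall_apply_eq_imp_iff₂,
    List.length_map, length_toList]
  intro q _
  refine (card_filter_le _ _).trans ?_
  rw [card_powerset]
  exact Nat.pow_le_pow_right two_pos (card_le_univ _)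

lemma Equations.Proper.slices {L : Equations A p} (hL : L.Proper) (J₀ : Finset ι) (z : ∀ i, A i) :
    (L.slices J₀ z).Proper := by
  intro q' hq'
  simp only [Equations.slices, List.mem_flatMap, List.mem_map, mem_toList, mem_filter] at hq'
  obtain ⟨q, hq, S, ⟨-, hS, -⟩, rfl⟩ := hq'
  exact ⟨hS, (hL q hq).2.piecewise_left S z⟩

lemma Equations.slices_ssubset {L : Equations A p} {J₀ : Finset ι} {z : ∀ i, A i} :
    ∀ q ∈ L.slices J₀ z, q.1 ⊂ J₀ := by
  intro q' hq'
  simp only [Equations.slices, List.mem_flatMap, List.mem_map, mem_toList, mem_filter,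
    mem_powerset] at hq'
  obtain ⟨q, hq, S, ⟨hSJ, -, hS⟩, rfl⟩ := hq'
  exact (inter_subset_right.trans hSJ).ssubset_of_ne hS

lemma Equations.Holds.slices {L : Equations A p} {J₀ : Finset ι} {z b : ∀ i, A i}
    (h : (L.slices J₀ z).Holds b) {q : Finset ι × ((∀ i, A i) → ZMod p)} (hq : q ∈ L)
    {S : Finset ι} (hS : S ⊆ J₀) (h1 : (q.1 ∩ S).Nonempty) (h2 : q.1 ∩ S ≠ J₀) :
    q.2 (S.piecewise b z) = 0 := by
  refine h (q.1 ∩ S, fun b => q.2 (S.piecewise b z)) ?_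
  simp only [Equations.slices, List.mem_flatMap, List.mem_map, mem_toList, mem_filter,
    mem_powerset]
  exact ⟨q, hq, S, ⟨hS, h1, h2⟩, rfl⟩

/-- The remaining equations after the coordinates in `J₀` have been fixed. -/
def Equations.fix (L : Equations A p) (J₀ : Finset ι) (a : ∀ i, A i) : Equations A p :=
  (L.filter fun q => (q.1 ∩ J₀).Nonempty ∧ ¬ q.1 ⊆ J₀).map
    fun q => (q.1 \ J₀, fun x => q.2 (J₀.piecewise a x))

lemma Equations.length_fix_le (L : Equations A p) (J₀ : Finset ι) (a : ∀ i, A i) :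
    (L.fix J₀ a).length ≤ L.length := by
  rw [fix, List.length_map]
  exact List.length_filter_le _ _

lemma Equations.Proper.fix {L : Equations A p} (hL : L.Proper) (J₀ : Finset ι) (a : ∀ i, A i) :
    (L.fix J₀ a).Proper := by
  intro q' hq'
  simp only [Equations.fix, List.mem_map, List.mem_filter, decide_eq_true_eq] at hq'
  obtain ⟨q, ⟨hq, -, hS⟩, rfl⟩ := hq'
  exact ⟨sdiff_nonempty.2 hS, (hL q hq).2.piecewise_right J₀ a⟩

variable [Fact p.Prime]

lemma VanishingTheorem.succ {k m d : ℕ} (hmk : m < k) (hS : StructureTheorem ι p m)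
    (hd : ∀ L, ∃ N, VanishingTheorem ι p k m d L N) (L : ℕ) :
    ∃ N, VanishingTheorem ι p k m (d + 1) L N := by
  set M := 2 * ((1 + (d + L)) * 2 ^ Fintype.card ι) with hM
  set η : ℝ := (((p : ℝ)⁻¹) ^ ((M + d) * Fintype.card ι)) ^ 2 ^ m with hη
  have hp : (0 : ℝ) < p := by exact_mod_cast (Fact.out : p.Prime).pos
  obtain ⟨N', hN'⟩ := hS η (by positivity)
  obtain ⟨N₀, hN₀⟩ := hd L
  obtain ⟨N₁, hN₁⟩ := hd (L + N')
  obtain ⟨N₂, hN₂⟩ := hd (L + (d + L))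
  refine ⟨N₀ + N₁ + (N₂ + 1), ?_⟩
  intro A _ _ I φ T W hI hφ hT hW hTm hWm hTd hWL hφ0
  rcases T with _ | ⟨⟨J₀, g₀⟩, T⟩
  · exact (hN₀ A I φ [] W hI hφ hT hW hTm hWm (by simp) hWL hφ0).mono (by omega)
  simp only [List.length_cons, add_le_add_iff_right] at hTd
  obtain ⟨⟨hJI, hJm⟩, hTm⟩ := List.forall_mem_cons.1 hTm
  obtain ⟨⟨hJ, hg₀⟩, hT⟩ := List.forall_mem_cons.1 hT
  dsimp only at hJI hJm hJ hg₀
  set H := (T.filter fun q => q.1 = J₀).map Prod.snd with hH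
  have hHlen : H.length ≤ d := by
    rw [hH, List.length_map]
    exact (List.length_filter_le _ _).trans hTd
  have hHm : ∀ h ∈ H, MultiaddOn J₀ h := by
    intro h hh
    simp only [hH, List.mem_map, List.mem_filter, decide_eq_true_eq] at hh
    obtain ⟨q, ⟨hq, hqJ⟩, rfl⟩ := hh
    exact hqJ ▸ (hT q hq).2
  have hHmem : ∀ q ∈ T, q.1 = J₀ → q.2 ∈ H := by
    intro q hq hqJ
    simp only [hH, List.mem_map, List.mem_filter, decide_eq_true_eq]
    exact ⟨q, ⟨hq, hqJ⟩, rfl⟩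
  by_cases hA : ∃ g, MultiaddOn J₀ g ∧ (∀ x, (∀ h ∈ H, h x = 0) → g x = g₀ x) ∧ η ≤ ‖charAvg g‖
  · obtain ⟨g, hg, hgg, hgη⟩ := hA
    obtain ⟨D, hD1, hD2, hD3⟩ := hN' A J₀ g hJm hg hgη
    refine (hN₁ A I φ T (W ++ D.map fun t => (t.1, t.2.1)) hI hφ hT (hW.append ?_) hTm ?_ hTd
      ?_ ?_).mono (by omega)
    · intro q hq
      obtain ⟨t, ht, rfl⟩ := List.mem_map.1 hq
      exact ⟨(hD2 t ht).1, (hD2 t ht).2.2.1⟩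
    · intro q hq
      rcases List.mem_append.1 hq with hq | hq
      · exact hWm q hq
      · obtain ⟨t, ht, rfl⟩ := List.mem_map.1 hq
        exact ⟨(hD2 t ht).2.1.subset.trans hJI, hJm ▸ card_lt_card (hD2 t ht).2.1⟩
    · rw [List.length_append, List.length_map]
      omega
    · intro x hTx hWx
      rw [Equations.holds_append] at hWx
      refine hφ0 x (List.forall_mem_cons.2 ⟨?_, hTx⟩) hWx.1
      dsimp only
      rw [← hgg x, hD3, List.sum_eq_zero]
      · intro r hr
        obtain ⟨t, ht, rfl⟩ := List.mem_map.1 hr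
        have ht0 : t.2.1 x = 0 := hWx.2 (t.1, t.2.1) (List.mem_map.2 ⟨t, ht, rfl⟩)
        rw [ht0, zero_mul]
      · intro h hh
        simp only [hH, List.mem_map, List.mem_filter, decide_eq_true_eq] at hh
        obtain ⟨q, ⟨hq, hqJ⟩, rfl⟩ := hh
        exact hTx q hq
  have hex : ∀ V : Equations A p, V.Proper → (∀ q ∈ V, q.1 ⊂ J₀) → V.length ≤ M → ∀ t,
      ∃ b, V.Holds b ∧ (∀ h ∈ H, h b = 0) ∧ g₀ b = t := by
    intro V hV hVJ hVM
    refine (exists_or_large_charAvg hJ hg₀ hHm hV hVJ).resolve_right fun ⟨g, hg, hgg, hgη⟩ => ?_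
    refine hA ⟨g, hg, hgg, le_trans ?_ hgη⟩
    rw [hη, hJm]
    refine pow_le_pow_left₀ (by positivity) (pow_le_pow_of_le_one (by positivity) ?_ ?_) _
    · exact inv_le_one_of_one_le₀ (by exact_mod_cast (Fact.out : p.Prime).one_le)
    · gcongr
  have hTW : Equations.Proper (T ++ W) := Equations.Proper.append (L := T) hT hW
  have hTWlen : (T ++ W).length ≤ d + L := by
    rw [List.length_append]
    omega
  have hTWI : ∀ q ∈ T ++ W, q.1 ⊆ I ∧ #q.1 ≤ m := fun q hq =>
    (List.mem_append.1 hq).elim (fun h => ⟨(hTm q h).1, (hTm q h).2.le⟩)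
      fun h => ⟨(hWm q h).1, (hWm q h).2.le⟩
  have hTWH : ∀ q ∈ T ++ W, q.1 = J₀ → q.2 ∈ H := by
    intro q hq hqJ
    refine (List.mem_append.1 hq).elim (fun h => hHmem q h hqJ) fun h => ?_
    have := (hWm q h).2
    rw [hqJ] at this
    omega
  have hpow : 0 < 2 ^ Fintype.card ι := by positivity
  obtain ⟨a, haV, haH, ha₀⟩ := hex ((T ++ W).filter fun q => q.1 ⊂ J₀)
    (fun q hq => hTW q (List.mem_filter.1 hq).1)
    (fun q hq => by simpa using (List.mem_filter.1 hq).2)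
    ((List.length_filter_le _ _).trans (hTWlen.trans (by rw [hM]; nlinarith))) 1
  have hproper : Equations.Proper ((J₀, g₀) :: (T ++ W)) :=
    List.forall_mem_cons.2 ⟨⟨hJ, hg₀⟩, hTW⟩
  have hlen : ((J₀, g₀) :: (T ++ W)).length ≤ 1 + (d + L) := by
    rw [List.length_cons]
    omega
  have hmain : Decomposable I N₂ fun x => φ x - g₀ x * φ (J₀.piecewise a x) := by
    have hψ : MultiaddOn I fun x => φ x - g₀ x * φ (J₀.piecewise a x) := by
      refine hφ.sub ?_
      have := hg₀.mul (hφ.piecewise_right J₀ a) disjoint_sdiff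
      rwa [union_sdiff_of_subset hJI] at this
    refine hN₂ A I _ T (W ++ Equations.fix (T ++ W) J₀ a) hI hψ hT
      (hW.append (hTW.fix J₀ a)) hTm ?_ hTd ?_ ?_
    · intro q hq
      rcases List.mem_append.1 hq with hq | hq
      · exact hWm q hq
      · simp only [Equations.fix, List.mem_map, List.mem_filter, decide_eq_true_eq] at hq
        obtain ⟨q, ⟨hqT, hq1, hq2⟩, rfl⟩ := hq
        refine ⟨sdiff_subset.trans (hTWI q hqT).1, lt_of_lt_of_le (card_lt_card ?_) (hTWI q hqT).2⟩
        refine sdiff_subset.ssubset_of_ne fun h => ?_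
        rw [Finset.sdiff_eq_self_iff_disjoint, disjoint_iff_inter_eq_empty] at h
        exact hq1.ne_empty h
    · rw [List.length_append]
      exact add_le_add hWL ((Equations.length_fix_le _ _ _).trans hTWlen)
    · intro x hTx hWx
      rw [Equations.holds_append] at hWx
      rw [sub_eq_zero]
      refine eq_mul_of_exists hJI hJ hφ hg₀ hTW (fun q hq h => ?_) (fun x h1 h2 => ?_) ha₀
        (fun q hq h => ?_) (fun z z' => ?_) (Equations.holds_append.2 ⟨hTx, hWx.1⟩)
        fun q hq h1 h2 => ?_
      · exact (eq_of_subset_of_card_le h (hJm ▸ (hTWI q hq).2)).symm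
      · rw [Equations.holds_append] at h2
        exact hφ0 x (List.forall_mem_cons.2 ⟨h1, h2.1⟩) h2.2
      · rcases h.eq_or_ssubset with h | h
        · exact haH _ (hTWH q hq h)
        · exact haV q (List.mem_filter.2 ⟨hq, by simpa using h⟩)
      · obtain ⟨b, hb, hbH, hb₀⟩ := hex
          (Equations.slices ((J₀, g₀) :: (T ++ W)) J₀ z ++
            Equations.slices ((J₀, g₀) :: (T ++ W)) J₀ z')
          ((hproper.slices _ _).append (hproper.slices _ _))
          (List.forall_mem_append.2 ⟨Equations.slices_ssubset, Equations.slices_ssubset⟩)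
          (by
            rw [List.length_append, hM, two_mul]
            exact add_le_add
              ((Equations.length_slices_le _ _ _).trans (Nat.mul_le_mul_right _ hlen))
              ((Equations.length_slices_le _ _ _).trans (Nat.mul_le_mul_right _ hlen))) (-1)
        rw [Equations.holds_append] at hb
        exact ⟨b, hb₀, fun q hq hqJ => hbH _ (hTWH q hq hqJ), fun q hq S hS h1 h2 =>
          ⟨hb.1.slices hq hS h1 h2, hb.2.slices hq hS h1 h2⟩⟩
      · refine hWx.2 (q.1 \ J₀, fun x => q.2 (J₀.piecewise a x)) ?_
        simp only [Equations.fix, List.mem_map, List.mem_filter, decide_eq_true_eq]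
        exact ⟨q, ⟨hq, h1, h2⟩, rfl⟩
  refine (hmain.of_sub_mul hJ (hJI.ssubset_of_ne ?_) hg₀ (hφ.piecewise_right J₀ a)).mono (by omega)
  rintro rfl
  omega

lemma exists_vanishingTheorem {k : ℕ} (hS : ∀ m, 0 < m → m < k → StructureTheorem ι p m) (m : ℕ)
    (hmk : m < k) (d L : ℕ) : ∃ N, VanishingTheorem ι p k m d L N := by
  induction m generalizing d L with
  | zero =>
    refine ⟨0, fun A _ _ I φ T W hI hφ hT hW hTm hWm hTd hWL hφ0 => ?_⟩
    refine Decomposable.of_eq_zero fun x => hφ0 x (fun q hq => ?_) (fun q hq => ?_)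
    · exact absurd (card_eq_zero.1 (hTm q hq).2) (hT q hq).1.ne_empty
    · exact absurd (hWm q hq).2 (Nat.not_lt_zero _)
  | succ m ihm =>
    induction d generalizing L with
    | zero =>
      obtain ⟨N, hN⟩ := ihm (by omega) L L
      refine ⟨N, fun A _ _ I φ T W hI hφ hT hW hTm hWm hTd hWL hφ0 => ?_⟩
      obtain rfl : T = [] := by simpa using hTd
      refine hN A I φ (W.filter fun q => #q.1 = m) (W.filter fun q => #q.1 < m) hI hφ
        (fun q hq => hW q (List.mem_filter.1 hq).1) (fun q hq => hW q (List.mem_filter.1 hq).1)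
        (fun q hq => ?_) (fun q hq => ?_) ((List.length_filter_le _ _).trans hWL)
        ((List.length_filter_le _ _).trans hWL) fun x h1 h2 => hφ0 x (by simp [Equations.Holds]) ?_
      · rw [List.mem_filter, decide_eq_true_eq] at hq
        exact ⟨(hWm q hq.1).1, hq.2⟩
      · rw [List.mem_filter, decide_eq_true_eq] at hq
        exact ⟨(hWm q hq.1).1, hq.2⟩
      · intro q hq
        rcases (Nat.lt_succ_iff.1 (hWm q hq).2).eq_or_lt with h | h
        · exact h1 q (List.mem_filter.2 ⟨hq, by simpa using h⟩)
        · exact h2 q (List.mem_filter.2 ⟨hq, by simpa using h⟩)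
    | succ d ihd => exact VanishingTheorem.succ hmk (hS _ m.succ_pos hmk) ihd L

end Decomposition

section InnerVariety

variable {ι : Type} [DecidableEq ι] {A : ι → Type} [∀ i, AddCommGroup (A i)]
  {p : ℕ} [Fact p.Prime] {I : Finset ι} {φ : (∀ i, A i) → ZMod p}
  {E : ι → Type} [∀ i, AddCommGroup (E i)]

/-- Every character of exponent `p` pulls back along `f i` to a character. -/
def IsQuasiHom (p : ℕ) (f : ∀ i, E i → A i) : Prop :=
  ∀ (i : ι) (l : A i →+ ZMod p) (a b : E i), l (f i (a + b)) = l (f i a) + l (f i b)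

lemma MultiaddOn.comp_quasiHom (hφ : MultiaddOn I φ) {f : ∀ i, E i → A i}
    (hf : IsQuasiHom p f) : MultiaddOn I fun e => φ fun i => f i (e i) := by
  have h : ∀ (e : ∀ i, E i) (i : ι) (a : E i), (fun j => f j (update e i a j)) =
      update (fun j => f j (e j)) i (f i a) := fun e i a => funext fun j => apply_update f e i a j
  refine ⟨fun i hi e a b => ?_, fun i hi e a => ?_⟩
  · simp only [h]
    exact hf i (hφ.updateHom hi _) a b
  · simp only [h]
    exact hφ.map_update_of_notMem i hi _ _

lemma MultiaddOn.piecewise_smul (hφ : MultiaddOn I φ) {S : Finset ι} (hS : S ⊆ I) (n : ι → ℕ)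
    (x y : ∀ i, A i) : φ (S.piecewise (fun i => n i • x i) y) =
      (∏ i ∈ S, (n i : ZMod p)) * φ (S.piecewise x y) := by
  induction S using Finset.induction_on generalizing y with
  | empty => simp
  | insert i S hi ih =>
    rw [insert_subset_iff] at hS
    have h : ∀ z : ∀ i, A i, (insert i S).piecewise z y = S.piecewise z (update y i (z i)) := by
      intro z
      rw [piecewise_insert, update_piecewise_of_notMem _ _ _ hi]
    rw [h, ih hS.2, ← update_piecewise_of_notMem _ _ _ hi, hφ.map_update_nsmul hS.1, prod_insert hi,
      nsmul_eq_mul, piecewise_insert]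
    ring

variable [Fintype ι] [∀ i, Fintype (A i)] [∀ i, Fintype (E i)]

open Classical in
lemma expect_re_stdAddChar_hom {G : Type*} [AddCommGroup G] [Fintype G] (f : G →+ ZMod p) :
    𝔼 a, (ZMod.stdAddChar (f a) : ℂ).re = if ∀ a, f a = 0 then 1 else 0 := by
  rw [← Complex.re_expect, expect_stdAddChar_hom]
  split_ifs <;> simp

lemma MultiaddOn.norm_charAvg_eq_expect_re (hφ : MultiaddOn I φ) (hI : I.Nonempty) :
    ‖charAvg φ‖ = 𝔼 x, (ZMod.stdAddChar (φ x) : ℂ).re := by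
  have := congrArg Complex.re (hφ.charAvg_eq_norm hI)
  rw [Complex.ofReal_re] at this
  rw [← this, charAvg, Complex.re_expect]

lemma MultiaddOn.norm_charAvg_le_comp (hφ : MultiaddOn I φ) (hI : I.Nonempty)
    {f : ∀ i, E i → A i} (hf : IsQuasiHom p f) :
    ‖charAvg φ‖ ≤ ‖charAvg fun e : ∀ i, E i => φ fun i => f i (e i)‖ := by
  classical
  rw [hφ.norm_charAvg_eq_expect_re hI, (hφ.comp_quasiHom hf).norm_charAvg_eq_expect_re hI]
  have key : ∀ S : Finset ι, 𝔼 x, (ZMod.stdAddChar (φ x) : ℂ).re ≤ 𝔼 e : ∀ i, E i, 𝔼 y,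
      (ZMod.stdAddChar (φ (S.piecewise (fun i => f i (e i)) y)) : ℂ).re := by
    intro S
    induction S using Finset.induction_on with
    | empty => simp
    | insert i S hi ih =>
      refine ih.trans ?_
      by_cases hiI : i ∈ I
      · rw [← expect_update i (fun e : ∀ i, E i => 𝔼 y,
          (ZMod.stdAddChar (φ ((insert i S).piecewise (fun i => f i (e i)) y)) : ℂ).re)]
        refine expect_le_expect fun e _ => ?_
        rw [← expect_update i, expect_comm (s := univ (α := E i))]
        refine expect_le_expect fun y _ => ?_
        have h1 : ∀ a, S.piecewise (fun i => f i (e i)) (update y i a) =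
            update (S.piecewise (fun i => f i (e i)) y) i a := fun a =>
          (update_piecewise_of_notMem S _ _ hi a).symm
        have h2 : ∀ b, (insert i S).piecewise (fun j => f j (update e i b j)) y =
            update (S.piecewise (fun i => f i (e i)) y) i (f i b) := by
          intro b
          rw [piecewise_insert, update_self]
          congr 1
          ext j
          by_cases hj : j ∈ S
          · simp [hj, update_of_ne (ne_of_mem_of_not_mem hj hi)]
          · simp [hj]
        simp only [h1, h2]
        have h3 := expect_re_stdAddChar_hom (hφ.updateHom hiI (S.piecewise (fun i => f i (e i)) y))
        have h4 := expect_re_stdAddChar_hom (AddMonoidHom.mk'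
          (fun b => hφ.updateHom hiI (S.piecewise (fun i => f i (e i)) y) (f i b)) (hf i _))
        simp only [MultiaddOn.updateHom_apply, AddMonoidHom.mk'_apply] at h3 h4
        rw [h3, h4]
        rcases em (∀ a, φ (update (S.piecewise (fun i => f i (e i)) y) i a) = 0) with h | h
        · exact ((if_pos h).trans (if_pos fun b => h _).symm).le
        · refine (if_neg h).le.trans ?_
          split_ifs
          exacts [zero_le_one, le_rfl]
      · refine expect_le_expect fun e _ => expect_le_expect fun y _ => ?_
        rw [piecewise_insert, hφ.map_update_of_notMem i hiI]
  simpa [Fintype.expect_const] using key univ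

/-- The average of a nonzero monomial is bounded away from `1`. -/
lemma norm_charAvg_prod_le (hI : I.Nonempty) {c : ZMod p} (hc : c ≠ 0) :
    ‖charAvg fun t : ι → ZMod p => (∏ i ∈ I, t i) * c‖ ≤ 1 - ((p : ℝ)⁻¹) ^ Fintype.card ι := by
  classical
  have hg : MultiaddOn I fun t : ι → ZMod p => (∏ i ∈ I, t i) * c := by
    refine ⟨fun i hi t a b => ?_, fun i hi t a => ?_⟩
    · simp only [← mul_prod_erase I _ hi, update_self, prod_congr rfl fun j hj =>
        update_of_ne (ne_of_mem_erase hj) _ t]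
      ring
    · simp only [prod_congr rfl fun j hj => update_of_ne (ne_of_mem_of_not_mem hj hi) _ t]
  obtain ⟨i, hi⟩ := hI
  rw [hg.norm_charAvg_eq hi]
  have h1 : ∀ t : ι → ZMod p, (if ∀ a, (∏ j ∈ I, update t i a j) * c = 0 then (1 : ℝ) else 0) ≤
      1 - if t = 1 then (1 : ℝ) else 0 := by
    intro t
    by_cases ht : t = 1
    · rw [if_neg, if_pos ht, sub_self]
      intro h
      refine hc ?_
      simpa [ht] using h 1
    · rw [if_neg ht, sub_zero]
      split_ifs <;> norm_num
  refine (expect_le_expect fun t _ => h1 t).trans_eq ?_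
  rw [expect_sub_distrib, Fintype.expect_const, Fintype.expect_eq_sum_div_card, sum_ite_eq' univ]
  simp [ZMod.card]

lemma charAvg_extend (hφ : MultiaddOn I φ) (hI : I.Nonempty) {f : ∀ i, E i → A i}
    {x : ∀ i, A i} (hx : ∀ e : ∀ i, E i, ∀ S ⊂ I, S.Nonempty →
      φ (S.piecewise x fun i => f i (e i)) = 0) :
    (charAvg fun e : ∀ i, E i × ZMod p => φ fun i => f i (e i).1 + (e i).2.val • x i) =
      (charAvg fun e : ∀ i, E i => φ fun i => f i (e i)) *
        charAvg fun t : ι → ZMod p => (∏ i ∈ I, t i) * φ x := by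
  have h1 : ∀ (e : ∀ i, E i) (t : ι → ZMod p), φ (fun i => f i (e i) + (t i).val • x i) =
      φ (fun i => f i (e i)) + (∏ i ∈ I, t i) * φ x := by
    intro e t
    have h2 := hφ.map_piecewise_add subset_rfl (fun i => (t i).val • x i) fun i => f i (e i)
    rw [hφ.congr (y := fun i => f i (e i) + (t i).val • x i)
      fun i hi => by simp [hi, add_comm]] at h2
    rw [h2, sum_congr rfl fun S hS => hφ.piecewise_smul (mem_powerset.1 hS) _ _ _]
    simp only [ZMod.natCast_zmod_val]
    have hne : (∅ : Finset ι) ≠ I := hI.ne_empty.symm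
    rw [← sum_subset (s₁ := {∅, I})]
    · rw [sum_pair hne, hφ.congr (x := I.piecewise x _) (y := x) fun i hi => by simp [hi]]
      simp
    · simp [insert_subset_iff]
    · intro S hS hS'
      simp only [mem_insert, mem_singleton, not_or] at hS'
      rw [hx e S ((mem_powerset.1 hS).ssubset_of_ne hS'.2) (nonempty_iff_ne_empty.2 hS'.1), mul_zero]
  let eqv : (∀ i, E i × ZMod p) ≃ (∀ i, E i) × (ι → ZMod p) :=
    ⟨fun e => (fun i => (e i).1, fun i => (e i).2), fun e i => (e.1 i, e.2 i), fun _ => rfl,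
      fun _ => rfl⟩
  simp only [charAvg]
  rw [Fintype.expect_mul_expect, Fintype.expect_equiv eqv _
    fun e => ZMod.stdAddChar (φ fun i => f i (e.1 i)) * ZMod.stdAddChar ((∏ i ∈ I, e.2 i) * φ x)]
  · rw [← univ_product_univ, expect_product]
  · intro e
    rw [h1 (fun i => (e i).1) fun i => (e i).2, AddChar.map_add_eq_mul]
    rfl

variable (A) in
/-- A family of groups of size at most `m` mapping to the groups `A i`. -/
structure Sampling (p m : ℕ) where
  /-- the groups -/
  E : ι → Type
  [grp : ∀ i, AddCommGroup (E i)]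
  [fin : ∀ i, Fintype (E i)]
  /-- the maps -/
  f : ∀ i, E i → A i
  isQuasiHom : IsQuasiHom p f
  card_le : ∀ i, Fintype.card (E i) ≤ m

attribute [instance] Sampling.grp Sampling.fin

lemma exists_sampling (hφ : MultiaddOn I φ) (hI : I.Nonempty) (n : ℕ) :
    (∃ s : Sampling A p (p ^ n), ∀ x, (∀ e : ∀ i, s.E i, ∀ S ⊂ I, S.Nonempty →
      φ (S.piecewise x fun i => s.f i (e i)) = 0) → φ x = 0) ∨
    ∃ s : Sampling A p (p ^ n), ‖charAvg fun e : ∀ i, s.E i => φ fun i => s.f i (e i)‖ ≤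
      (1 - ((p : ℝ)⁻¹) ^ Fintype.card ι) ^ n := by
  induction n with
  | zero =>
    right
    refine ⟨⟨fun _ => PUnit, fun _ _ => 0, fun i l a b => by simp, by simp⟩, ?_⟩
    simpa using norm_charAvg_le_one _
  | succ n ih =>
    have hp : p ^ n ≤ p ^ (n + 1) := Nat.pow_le_pow_right (Fact.out : p.Prime).pos n.le_succ
    rcases ih with ⟨s, hs⟩ | ⟨s, hs⟩
    · exact Or.inl ⟨⟨s.E, s.f, s.isQuasiHom, fun i => (s.card_le i).trans hp⟩, hs⟩
    by_cases h : ∀ x, (∀ e : ∀ i, s.E i, ∀ S ⊂ I, S.Nonempty →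
      φ (S.piecewise x fun i => s.f i (e i)) = 0) → φ x = 0
    · exact Or.inl ⟨⟨s.E, s.f, s.isQuasiHom, fun i => (s.card_le i).trans hp⟩, h⟩
    push Not at h
    obtain ⟨x, hx, hx0⟩ := h
    refine Or.inr ⟨⟨fun i => s.E i × ZMod p, fun i e => s.f i e.1 + e.2.val • x i, ?_, ?_⟩, ?_⟩
    · intro i l a b
      simp only [Prod.fst_add, Prod.snd_add, map_add, map_nsmul, nsmul_eq_mul, ZMod.natCast_val,
        ZMod.cast_id', id, s.isQuasiHom i l]
      ring
    · intro i
      rw [Fintype.card_prod, ZMod.card, pow_succ]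
      exact Nat.mul_le_mul_right _ (s.card_le i)
    · dsimp only
      rw [charAvg_extend hφ hI hx, norm_mul, pow_succ]
      exact mul_le_mul hs (norm_charAvg_prod_le hI hx0) (norm_nonneg _)
        ((norm_nonneg _).trans hs)

/-- A form of large average vanishes on the solutions of boundedly many equations of smaller
degree. -/
lemma exists_innerVariety (ι : Type) [Fintype ι] [DecidableEq ι] (p : ℕ) [Fact p.Prime] {η : ℝ}
    (hη : 0 < η) : ∃ L₀ : ℕ, ∀ (A : ι → Type) [∀ i, AddCommGroup (A i)] [∀ i, Fintype (A i)]
      (I : Finset ι) (φ : (∀ i, A i) → ZMod p), I.Nonempty → MultiaddOn I φ → η ≤ ‖charAvg φ‖ →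
      ∃ L : Equations A p, L.Proper ∧ (∀ q ∈ L, q.1 ⊂ I) ∧ L.length ≤ L₀ ∧
        ∀ x, L.Holds x → φ x = 0 := by
  have hp : (0 : ℝ) < p := by exact_mod_cast (Fact.out : p.Prime).pos
  obtain ⟨n, hn⟩ := exists_pow_lt_of_lt_one hη
    (show 1 - ((p : ℝ)⁻¹) ^ Fintype.card ι < 1 by linarith [show 0 < ((p : ℝ)⁻¹) ^ Fintype.card ι by positivity])
  refine ⟨(p ^ n) ^ Fintype.card ι * 2 ^ Fintype.card ι, fun A _ _ I φ hI hφ hφη => ?_⟩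
  rcases exists_sampling hφ hI n with ⟨s, hs⟩ | ⟨s, hs⟩
  · refine ⟨(univ : Finset (∀ i, s.E i)).toList.flatMap fun e =>
      (I.ssubsets.filter Finset.Nonempty).toList.map fun S =>
        (S, fun x => φ (S.piecewise x fun i => s.f i (e i))), ?_, ?_, ?_, fun x hx => hs x ?_⟩
    · intro q hq
      simp only [List.mem_flatMap, List.mem_map, mem_toList, mem_filter, mem_ssubsets] at hq
      obtain ⟨e, -, S, ⟨hSI, hS⟩, rfl⟩ := hq
      refine ⟨hS, ?_⟩
      have := hφ.piecewise_left S fun i => s.f i (e i)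
      rwa [inter_eq_right.2 hSI.subset] at this
    · intro q hq
      simp only [List.mem_flatMap, List.mem_map, mem_toList, mem_filter, mem_ssubsets] at hq
      obtain ⟨e, -, S, ⟨hSI, hS⟩, rfl⟩ := hq
      exact hSI
    · rw [List.length_flatMap]
      refine (List.sum_le_card_nsmul _ (2 ^ Fintype.card ι) ?_).trans ?_
      · simp only [List.mem_map, forall_exists_index, and_imp, forall_apply_eq_imp_iff₂,
          List.length_map, length_toList]
        intro e _
        refine (card_le_univ _).trans_eq ?_
        simp
      · rw [List.length_map, length_toList, card_univ, Fintype.card_pi, smul_eq_mul]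
        refine Nat.mul_le_mul_right _ ((prod_le_pow_card _ _ _ fun i _ => s.card_le i).trans_eq ?_)
        simp
    · intro e S hSI hS
      refine hx (S, fun x => φ (S.piecewise x fun i => s.f i (e i))) ?_
      simp only [List.mem_flatMap, List.mem_map, mem_toList, mem_filter, mem_ssubsets]
      exact ⟨e, mem_univ _, S, ⟨hSI, hS⟩, rfl⟩
  · exact absurd (hφη.trans ((hφ.norm_charAvg_le_comp hI s.isQuasiHom).trans hs)) hn.not_ge

theorem structureTheorem (ι : Type) [Fintype ι] [DecidableEq ι] (p : ℕ) [Fact p.Prime] (k : ℕ)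
    (hk : 0 < k) : StructureTheorem ι p k := by
  induction k using Nat.strong_induction_on with
  | _ k ih =>
    intro η hη
    obtain ⟨L₀, hL₀⟩ := exists_innerVariety ι p hη
    obtain ⟨N, hN⟩ := exists_vanishingTheorem (ι := ι) (p := p) (k := k)
      (fun m hm hmk => ih m hmk hm) (k - 1) (by omega) L₀ L₀
    refine ⟨N, fun A _ _ I φ hI hφ hφη => ?_⟩
    obtain ⟨L, hL, hLI, hL0, hLφ⟩ := hL₀ A I φ (card_pos.1 (hI ▸ hk)) hφ hφη
    refine hN A I φ (L.filter fun q => #q.1 = k - 1) (L.filter fun q => #q.1 < k - 1) hI hφ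
        (fun q hq => hL q (List.mem_filter.1 hq).1) (fun q hq => hL q (List.mem_filter.1 hq).1)
        (fun q hq => ?_) (fun q hq => ?_) ((List.length_filter_le _ _).trans hL0)
        ((List.length_filter_le _ _).trans hL0) fun x h1 h2 => hLφ x fun q hq => ?_
    · rw [List.mem_filter, decide_eq_true_eq] at hq
      exact ⟨(hLI q hq.1).subset, hq.2⟩
    · rw [List.mem_filter, decide_eq_true_eq] at hq
      exact ⟨(hLI q hq.1).subset, hq.2⟩
    · have := card_lt_card (hLI q hq)
      rcases (show #q.1 ≤ k - 1 by omega).eq_or_lt with h | h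
      · exact h1 q (List.mem_filter.2 ⟨hq, by simpa using h⟩)
      · exact h2 q (List.mem_filter.2 ⟨hq, by simpa using h⟩)

end InnerVariety

section Piece

variable {ι : Type} [DecidableEq ι] [Fintype ι] {A : ι → Type} [∀ i, AddCommGroup (A i)]
  {B C : Type} [AddCommGroup B] [AddCommGroup C] {I : Finset ι}

lemma MultiaddOn.of_comp_injective {F : (∀ i, A i) → B} {f : B →+ C} (hf : Injective f)
    (h : MultiaddOn I fun x => f (F x)) : MultiaddOn I F where
  map_update_add i hi x a b := hf <| by rw [map_add]; exact h.map_update_add i hi x a b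
  map_update_of_notMem i hi x a := hf <| h.map_update_of_notMem i hi x a

variable (A B) in
/-- A product `g(x_I) • G(x_{Iᶜ})`, where `g` is multiadditive modulo `q ≤ Q` and `q • G = 0`. -/
structure Piece (Q : ℕ) where
  /-- the coordinates of `g` -/
  I : Finset ι
  nonempty : I.Nonempty
  /-- the modulus -/
  q : ℕ
  q_pos : 0 < q
  q_le : q ≤ Q
  /-- the scalar factor -/
  g : (∀ i, A i) → ℤ
  g_multiaddOn : MultiaddOn I fun x => (g x : ZMod q)
  /-- the vector factor -/
  G : (∀ i, A i) → B
  G_multiaddOn : MultiaddOn Iᶜ G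
  smul_G : ∀ x, q • G x = 0

/-- The product of the two factors. -/
def Piece.eval {Q : ℕ} (t : Piece A B Q) (x : ∀ i, A i) : B := t.g x • t.G x

/-- `F` is a sum of at most `N` pieces of modulus at most `Q`. -/
def HasStructure (N Q : ℕ) (F : (∀ i, A i) → B) : Prop :=
  ∃ T : List (Piece A B Q), T.length ≤ N ∧ ∀ x, F x = (T.map fun t => t.eval x).sum

/-- The image of a piece under a homomorphism. -/
def Piece.map {Q : ℕ} (t : Piece A B Q) (f : B →+ C) : Piece A C Q where
  __ := t
  G x := f (t.G x)
  G_multiaddOn := t.G_multiaddOn.comp_hom f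
  smul_G x := by rw [← map_nsmul, t.smul_G, map_zero]

lemma Piece.eval_map {Q : ℕ} (t : Piece A B Q) (f : B →+ C) (x : ∀ i, A i) :
    (t.map f).eval x = f (t.eval x) := (map_zsmul f _ _).symm

lemma HasStructure.map {N Q : ℕ} {F : (∀ i, A i) → B} (h : HasStructure N Q F) (f : B →+ C) :
    HasStructure N Q fun x => f (F x) := by
  obtain ⟨T, h1, h2⟩ := h
  refine ⟨T.map fun t => t.map f, by simpa using h1, fun x => ?_⟩
  dsimp only
  rw [h2, map_list_sum, List.map_map, List.map_map]
  congr 1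
  exact List.map_congr_left fun t _ => (t.eval_map f x).symm

end Piece

section Option

variable {ι : Type} [DecidableEq ι] {A : ι → Type} [∀ i, AddCommGroup (A i)] {V : Type}
  [AddCommGroup V]

/-- The family `A` with one more member `V`. -/
def AddFactor (A : ι → Type) (V : Type) : Option ι → Type
  | none => V
  | some i => A i

instance : ∀ o, AddCommGroup (AddFactor A V o)
  | none => inferInstanceAs (AddCommGroup V)
  | some i => inferInstanceAs (AddCommGroup (A i))

instance [∀ i, Fintype (A i)] [Fintype V] : ∀ o, Fintype (AddFactor A V o)
  | none => inferInstanceAs (Fintype V)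
  | some i => inferInstanceAs (Fintype (A i))

/-- Extending a tuple by one entry. -/
def consTuple (v : V) (x : ∀ i, A i) : ∀ o, AddFactor A V o
  | none => v
  | some i => x i

lemma consTuple_update (v : V) (x : ∀ i, A i) (i : ι) (a : A i) :
    consTuple v (update x i a) = update (consTuple v x) (some i) a := by
  funext o
  rcases o with _ | j
  · rfl
  · rcases eq_or_ne j i with rfl | h
    · exact (update_self j a x).trans (update_self (some j) _ (consTuple v x)).symm
    · exact (update_of_ne h a x).trans
        (update_of_ne (fun h' => h (Option.some_injective _ h')) _ (consTuple v x)).symm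

lemma update_consTuple_none (v : V) (x : ∀ i, A i) (w : AddFactor A V none) :
    update (consTuple v x) none w = consTuple (A := A) (V := V) w x := by
  funext o
  rcases o with _ | j
  · exact update_self none w (consTuple v x)
  · rfl

lemma exists_eq_consTuple (z : ∀ o, AddFactor A V o) : ∃ v x, z = consTuple v x :=
  ⟨z none, fun i => z (some i), by funext o; rcases o with _ | _ <;> rfl⟩

variable {B : Type} [AddCommGroup B] [Fintype ι] {J : Finset (Option ι)}
  {b : (∀ o, AddFactor A V o) → B}

lemma MultiaddOn.comp_consTuple (hb : MultiaddOn J b) (v : V) :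
    MultiaddOn ({i | some i ∈ J} : Finset ι) fun x => b (consTuple v x) where
  map_update_add i hi x c d := by
    simp only [consTuple_update]
    exact hb.map_update_add (some i) (by simpa using hi) _ c d
  map_update_of_notMem i hi x c := by
    simp only [consTuple_update]
    exact hb.map_update_of_notMem (some i) (by simpa using hi) _ c

lemma MultiaddOn.pi {κ : Type} {G : κ → (∀ i, A i) → B} {I : Finset ι}
    (hG : ∀ k, MultiaddOn I (G k)) : MultiaddOn I fun x k => G k x where
  map_update_add i hi x a b := funext fun k => (hG k).map_update_add i hi x a b
  map_update_of_notMem i hi x a := funext fun k => (hG k).map_update_of_notMem i hi x a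

end Option

section Torsion

variable {ι : Type} [DecidableEq ι] [Fintype ι] {A : ι → Type} [∀ i, AddCommGroup (A i)]
  {p : ℕ} [Fact p.Prime] {r : ℕ}

lemma exists_piece {J : Finset (Option ι)} {a b : (∀ o, AddFactor A (Fin r → ZMod p) o) → ZMod p}
    (hJ : J.Nonempty) (hn : none ∉ J) (ha : MultiaddOn J a) (hb : MultiaddOn Jᶜ b) :
    ∃ t : Piece A (Fin r → ZMod p) p, ∀ x, t.eval x =
      fun j => a (consTuple (Pi.single j 1) x) * b (consTuple (Pi.single j 1) x) := by
  refine ⟨⟨({i | some i ∈ J} : Finset ι), ?_, p, (Fact.out : p.Prime).pos, le_rfl,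
    fun x => (a (consTuple 0 x)).val, ?_, fun x j => b (consTuple (Pi.single j 1) x), ?_, ?_⟩, ?_⟩
  · obtain ⟨o, ho⟩ := hJ
    rcases o with _ | i
    · exact absurd ho hn
    · exact ⟨i, by simpa using ho⟩
  · simpa using ha.comp_consTuple 0
  · refine MultiaddOn.pi fun j => ?_
    have := hb.comp_consTuple (Pi.single j 1)
    convert this using 1
    ext i
    simp
  · intro x
    ext j
    simp
  · intro x
    ext j
    have h : a (consTuple (Pi.single j 1) x) = a (consTuple 0 x) := by
      refine ha.congr fun o ho => ?_
      rcases o with _ | i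
      · exact absurd ho hn
      · rfl
    simp [Piece.eval, h]

/-- The form on the extended product associated with a vector valued map. -/
def pairing (c : (∀ i, A i) → Fin r → ZMod p) (z : ∀ o, AddFactor A (Fin r → ZMod p) o) : ZMod p :=
  ∑ j, (show Fin r → ZMod p from z none) j * c (fun i => z (some i)) j

lemma pairing_consTuple (c : (∀ i, A i) → Fin r → ZMod p) (v : Fin r → ZMod p) (x : ∀ i, A i) :
    pairing c (consTuple v x) = ∑ j, v j * c x j := rfl

lemma multiaddOn_pairing {c : (∀ i, A i) → Fin r → ZMod p} (hc : MultiaddOn univ c) :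
    MultiaddOn univ (pairing c) where
  map_update_add o ho z a b := by
    obtain ⟨v, x, rfl⟩ := exists_eq_consTuple z
    rcases o with _ | i
    · have key : ∀ u w : Fin r → ZMod p, pairing c (consTuple (u + w) x) =
          pairing c (consTuple u x) + pairing c (consTuple w x) := by
        intro u w
        simp only [pairing_consTuple, Pi.add_apply, add_mul, sum_add_distrib]
      rw [update_consTuple_none, update_consTuple_none, update_consTuple_none]
      exact key a b
    · have key : ∀ a b : A i, pairing c (consTuple v (update x i (a + b))) =
          pairing c (consTuple v (update x i a)) + pairing c (consTuple v (update x i b)) := by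
        intro a b
        simp only [pairing_consTuple, hc.map_update_add i (mem_univ _), Pi.add_apply, mul_add,
          sum_add_distrib]
      simp only [consTuple_update] at key
      exact key a b
  map_update_of_notMem o ho := absurd (mem_univ o) ho

variable [∀ i, Fintype (A i)]

lemma norm_charAvg_pairing {c : (∀ i, A i) → Fin r → ZMod p} (hc : MultiaddOn univ c) :
    ‖charAvg (pairing c)‖ = zeroDens c := by
  classical
  rw [(multiaddOn_pairing hc).norm_charAvg_eq (mem_univ none), zeroDens]
  refine Eq.trans ?_ (expect_comp_of_surjective (G := ∀ o, AddFactor A (Fin r → ZMod p) o) (M := ℝ)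
    (AddMonoidHom.mk' (fun z i => z (some i)) fun _ _ => rfl) (fun x => ⟨consTuple 0 x, rfl⟩) _)
  refine expect_congr rfl fun z _ => ?_
  obtain ⟨v, x, rfl⟩ := exists_eq_consTuple z
  have h : (∀ a : AddFactor A (Fin r → ZMod p) none,
      pairing c (update (consTuple v x) none a) = 0) ↔ c x = 0 := by
    refine ⟨fun h => funext fun j => ?_, fun h a => ?_⟩
    · have h1 : ∀ w : Fin r → ZMod p, pairing c (consTuple w x) = 0 := fun w =>
        (congrArg (pairing c) (update_consTuple_none v x w)).symm.trans (h w)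
      simpa [pairing_consTuple, Pi.single_apply] using h1 (Pi.single j 1)
    · have h1 : ∀ w : Fin r → ZMod p, pairing c (consTuple w x) = 0 := by
        simp [pairing_consTuple, h]
      exact (congrArg (pairing c) (update_consTuple_none v x a)).trans (h1 a)
  by_cases hx : c x = 0
  · exact (if_pos (h.2 hx)).trans (if_pos hx).symm
  · exact (if_neg fun h' => hx (h.1 h')).trans (if_neg hx).symm

lemma exists_hasStructure_of_vector (ι : Type) [Fintype ι] [DecidableEq ι] (p : ℕ) [Fact p.Prime]
    {ε : ℝ} (hε : 0 < ε) : ∃ N, ∀ (A : ι → Type) [∀ i, AddCommGroup (A i)] [∀ i, Fintype (A i)]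
      (r : ℕ) (c : (∀ i, A i) → Fin r → ZMod p), MultiaddOn univ c → ε ≤ zeroDens c →
      HasStructure N p c := by
  obtain ⟨N, hN⟩ := structureTheorem (Option ι) p (Fintype.card (Option ι)) Fintype.card_pos ε hε
  refine ⟨N, fun A _ _ r c hc hcε => ?_⟩
  obtain ⟨T, hTN, hT, hTc⟩ := hN (AddFactor A (Fin r → ZMod p)) univ (pairing c) rfl
    (multiaddOn_pairing hc) (hcε.trans_eq (norm_charAvg_pairing hc).symm)
  have h1 : ∀ t : {t // t ∈ T}, ∃ s : Piece A (Fin r → ZMod p) p, ∀ x, s.eval x = fun j =>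
      t.1.2.1 (consTuple (Pi.single j 1) x) * t.1.2.2 (consTuple (Pi.single j 1) x) := by
    rintro ⟨⟨J, a, b⟩, ht⟩
    obtain ⟨hJ, hJ', ha, hb⟩ := hT _ ht
    dsimp only at hJ hJ' ha hb ⊢
    rw [← compl_eq_univ_sdiff] at hb
    by_cases hn : none ∈ J
    · obtain ⟨s, hs⟩ := exists_piece (J := Jᶜ) (by
          rwa [nonempty_iff_ne_empty, Ne, compl_eq_empty_iff, ← Ne, ← ssubset_univ_iff])
        (by simpa using hn) hb (by rwa [compl_compl])
      exact ⟨s, fun x => by simp only [hs, mul_comm]⟩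
    · exact exists_piece hJ hn ha hb
  choose s hs using h1
  refine ⟨T.attach.map s, by simpa using hTN, fun x => ?_⟩
  ext j
  have h2 := hTc (consTuple (Pi.single j 1) x)
  rw [pairing_consTuple] at h2
  rw [show c x j = ∑ i, (Pi.single j 1 : Fin r → ZMod p) i * c x i by simp [Pi.single_apply], h2,
    List.map_map]
  refine Eq.trans ?_ (map_list_sum (Pi.evalAddMonoidHom (fun _ => ZMod p) j) _).symm
  rw [List.map_map]
  conv_lhs => rw [← List.attach_map_subtype_val T, List.map_map]
  congr 1
  simp [hs, Function.comp_def]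

lemma exists_equiv_pi_zmod {V : Type} [AddCommGroup V] [Finite V] (h : ∀ v : V, p • v = 0) :
    ∃ r, Nonempty (V ≃+ (Fin r → ZMod p)) := by
  have _m : Module (ZMod p) V := AddCommGroup.zmodModule h
  have : Module.Finite (ZMod p) V := Module.Finite.of_finite
  exact ⟨_, ⟨(Module.finBasis (ZMod p) V).equivFun.toAddEquiv⟩⟩

lemma exists_torsion_coordinates (B : Type) [AddCommGroup B] [Finite B] :
    ∃ (r : ℕ) (f : (Fin r → ZMod p) →+ B), Injective f ∧ ∀ b, p • b = 0 → b ∈ f.range := by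
  let S : AddSubgroup B := (nsmulAddMonoidHom p : B →+ B).ker
  obtain ⟨r, ⟨e⟩⟩ := exists_equiv_pi_zmod (p := p) (V := S) fun x => Subtype.ext x.2
  refine ⟨r, S.subtype.comp e.symm.toAddMonoidHom, ?_, fun b hb => ?_⟩
  · exact S.subtype_injective.comp e.symm.injective
  · exact ⟨e ⟨b, hb⟩, by simp⟩

/-- Maps with values killed by a prime. -/
lemma exists_hasStructure_of_prime (ι : Type) [Fintype ι] [DecidableEq ι] (p : ℕ) [Fact p.Prime]
    {ε : ℝ} (hε : 0 < ε) : ∃ N, ∀ (A : ι → Type) [∀ i, AddCommGroup (A i)] [∀ i, Fintype (A i)]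
      (B : Type) [AddCommGroup B] [Finite B] (F : (∀ i, A i) → B), MultiaddOn univ F →
      ε ≤ zeroDens F → (∀ x, p • F x = 0) → HasStructure N p F := by
  obtain ⟨N, hN⟩ := exists_hasStructure_of_vector ι p hε
  refine ⟨N, fun A _ _ B _ _ F hF hFε hFp => ?_⟩
  obtain ⟨r, f, hf, hfp⟩ := exists_torsion_coordinates (p := p) B
  choose c hc using fun x => hfp (F x) (hFp x)
  obtain rfl : (fun x => f (c x)) = F := funext hc
  exact (hN A r c (.of_comp_injective hf hF)
    (hFε.trans (zeroDens_mono fun x hx => hf (hx.trans (map_zero f).symm)))).map f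

end Torsion

section Dense

variable {ι : Type} [DecidableEq ι] [Fintype ι] {A : ι → Type} [∀ i, AddCommGroup (A i)]
  [∀ i, Fintype (A i)] {B C : Type} [AddCommGroup B] [AddCommGroup C] {I : Finset ι}

lemma exists_dense_slices {ε : ℝ} (hε : 0 ≤ ε) {F : (∀ i, A i) → B} (hF : ε ≤ zeroDens F) (i : ι) :
    ∃ X : Finset (A i), ε / 2 * Fintype.card (A i) ≤ #X ∧
      ∀ a ∈ X, ε / 2 ≤ zeroDens fun x => F (update x i a) := by
  classical
  refine ⟨univ.filter fun a => ε / 2 ≤ zeroDens fun x => F (update x i a), ?_, by simp⟩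
  rw [zeroDens_update i] at hF
  have := half_le_expect_ite (fun a => zeroDens_le_one fun x => F (update x i a)) hε hF
  rw [Fintype.expect_eq_sum_div_card, sum_boole, le_div_iff₀ (by positivity)] at this
  exact this

lemma MultiaddOn.eq_zero_of_card_eq_zero {F : (∀ i, A i) → B} (hF : MultiaddOn I F) (hI : #I = 0)
    (h : 0 < zeroDens F) (x : ∀ i, A i) : F x = 0 := by
  by_contra hx
  refine h.ne' (expect_eq_zero fun y _ => if_neg fun hy => hx ?_)
  rw [← hy]
  refine hF.congr fun i hi => ?_
  rw [card_eq_zero.1 hI] at hi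
  exact absurd hi (notMem_empty i)

lemma exists_nsmul_eq_zero (ι : Type) [Fintype ι] [DecidableEq ι] (n : ℕ) {ε : ℝ} (hε : 0 < ε) :
    ∃ M : ℕ, 0 < M ∧ ∀ (A : ι → Type) [∀ i, AddCommGroup (A i)] [∀ i, Fintype (A i)]
      (B : Type) [AddCommGroup B] (I : Finset ι) (F : (∀ i, A i) → B), #I = n → MultiaddOn I F →
      ε ≤ zeroDens F → ∀ x, M • F x = 0 := by
  induction n generalizing ε with
  | zero =>
    exact ⟨1, one_pos, fun A _ _ B _ I F hI hF hFε x => by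
      rw [one_smul, hF.eq_zero_of_card_eq_zero hI (hε.trans_le hFε)]⟩
  | succ n ih =>
    obtain ⟨M, hM, h⟩ := ih (half_pos hε)
    refine ⟨M * Nat.factorial ⌊2 / ε⌋₊, by positivity, fun A _ _ B _ I F hI hF hFε x => ?_⟩
    obtain ⟨i, hi⟩ := card_pos.1 (by omega : 0 < #I)
    obtain ⟨X, hX, hXF⟩ := exists_dense_slices hε.le hFε i
    let K : AddSubgroup (A i) :=
      { carrier := {a | ∀ x, M • F (update x i a) = 0}
        zero_mem' := fun x => by rw [hF.map_update_zero hi, smul_zero]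
        add_mem' := fun ha hb x => by rw [hF.map_update_add i hi, smul_add, ha, hb, add_zero]
        neg_mem' := fun ha x => by rw [hF.map_update_neg hi, smul_neg, ha, neg_zero] }
    have hXK : ∀ a ∈ X, a ∈ K := fun a ha =>
      h A B (I.erase i) _ (by rw [card_erase_of_mem hi, hI, Nat.add_sub_cancel])
        (hF.update_const i a) (hXF a ha)
    have h1 : #X ≤ Nat.card K := by
      rw [← Fintype.card_coe X, ← Nat.card_eq_fintype_card]
      exact Nat.card_le_card_of_injective (fun a : X => (⟨a, hXK a a.2⟩ : K)) fun a b h =>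
        Subtype.ext (congrArg (fun c : K => (c : A i)) h)
    have h2 : (K.index : ℝ) ≤ 2 / ε := by
      have h3 : (K.index * Nat.card K : ℝ) = Fintype.card (A i) := by
        rw [← Nat.card_eq_fintype_card]
        exact_mod_cast K.index_mul_card
      have h4 : (0 : ℝ) < Nat.card K := by exact_mod_cast Nat.card_pos
      have h5 : (#X : ℝ) ≤ Nat.card K := by exact_mod_cast h1
      rw [le_div_iff₀ hε]
      nlinarith
    have h3 : Nat.factorial ⌊2 / ε⌋₊ • x i ∈ K := by
      obtain ⟨c, hc⟩ := Nat.dvd_factorial (Nat.pos_of_ne_zero K.index_ne_zero_of_finite)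
        (Nat.le_floor h2)
      rw [hc, mul_comm, mul_smul]
      exact K.nsmul_mem (K.nsmul_index_mem _) _
    have h4 := h3 x
    rwa [hF.map_update_nsmul_self hi, ← mul_smul] at h4

lemma exists_difference_sets {G : Type} [AddCommGroup G] [Fintype G] [DecidableEq G]
    (X Y : Finset G) : ∃ Z : Finset G, (#X * #Y : ℝ) ≤ Fintype.card G * #Z ∧
      ∀ a ∈ Z, (∃ x ∈ X, ∃ x' ∈ X, a = x - x') ∧ ∃ y ∈ Y, ∃ y' ∈ Y, a = y - y' := by
  rcases (X ×ˢ Y).eq_empty_or_nonempty with h | h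
  · refine ⟨∅, ?_, by simp⟩
    rw [← card_eq_zero, card_product] at h
    exact_mod_cast (by simp [h])
  have hG : (0 : ℝ) < Fintype.card G := by exact_mod_cast Fintype.card_pos
  obtain ⟨s, -, hs⟩ := exists_le_card_fiber_of_nsmul_le_card_of_maps_to (s := X ×ˢ Y)
    (t := (univ : Finset G)) (f := fun q => q.1 + q.2) (b := (#X * #Y : ℝ) / Fintype.card G)
    (fun _ _ => mem_univ _) univ_nonempty (by
      rw [card_univ, nsmul_eq_mul, mul_div_cancel₀ _ hG.ne', card_product]
      push_cast
      exact le_rfl)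
  set P : Finset (G × G) := {q ∈ X ×ˢ Y | q.1 + q.2 = s} with hP
  have hPmem : ∀ q ∈ P, q.1 ∈ X ∧ q.2 ∈ Y ∧ q.1 + q.2 = s := by simp [hP, and_assoc]
  rw [div_le_iff₀ hG, mul_comm _ (Fintype.card G : ℝ)] at hs
  rcases P.eq_empty_or_nonempty with h0 | ⟨q₀, hq₀⟩
  · exact ⟨∅, by simpa [h0] using hs, by simp⟩
  refine ⟨P.image fun q => q.1 - q₀.1, ?_, ?_⟩
  · rwa [card_image_of_injOn]
    intro q hq q' hq' h
    have h1 : q.1 = q'.1 := sub_left_injective h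
    refine Prod.ext h1 (add_left_cancel (a := q.1) ?_)
    rw [(hPmem q hq).2.2, h1, (hPmem q' hq').2.2]
  · intro a ha
    obtain ⟨q, hq, rfl⟩ := mem_image.1 ha
    refine ⟨⟨_, (hPmem q hq).1, _, (hPmem q₀ hq₀).1, rfl⟩, _, (hPmem q₀ hq₀).2.1, _,
      (hPmem q hq).2.1, ?_⟩
    rw [sub_eq_sub_iff_add_eq_add, (hPmem q hq).2.2, add_comm, (hPmem q₀ hq₀).2.2]

lemma le_expect_of_le_on {X : Type} [Fintype X] [Nonempty X] {u : X → ℝ} (hu : ∀ x, 0 ≤ u x)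
    {Z : Finset X} {c d : ℝ} (hc : 0 ≤ c) (hZ : d * Fintype.card X ≤ #Z) (h : ∀ x ∈ Z, c ≤ u x) :
    c * d ≤ 𝔼 x, u x := by
  rw [Fintype.expect_eq_sum_div_card, le_div_iff₀ (by positivity)]
  calc c * d * Fintype.card X ≤ #Z • c := by rw [nsmul_eq_mul]; nlinarith
    _ ≤ ∑ x ∈ Z, u x := card_nsmul_le_sum _ _ _ h
    _ ≤ ∑ x, u x := sum_le_sum_of_subset_of_nonneg (subset_univ _) fun x _ _ => hu x

lemma exists_le_zeroDens_prod (ι : Type) [Fintype ι] [DecidableEq ι] (n : ℕ) {ε δ : ℝ}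
    (hε : 0 < ε) (hδ : 0 < δ) :
    ∃ ρ : ℝ, 0 < ρ ∧ ∀ (A : ι → Type) [∀ i, AddCommGroup (A i)] [∀ i, Fintype (A i)]
      (B C : Type) [AddCommGroup B] [AddCommGroup C] (I : Finset ι) (F : (∀ i, A i) → B)
      (G : (∀ i, A i) → C), #I = n → MultiaddOn I F → MultiaddOn I G →
      ε ≤ zeroDens F → δ ≤ zeroDens G → ρ ≤ zeroDens fun x => (F x, G x) := by
  induction n generalizing ε δ with
  | zero =>
    refine ⟨1, one_pos, fun A _ _ B C _ _ I F G hI hF hG hFε hGδ => ?_⟩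
    rw [zeroDens_eq_one]
    intro x
    rw [hF.eq_zero_of_card_eq_zero hI (hε.trans_le hFε),
      hG.eq_zero_of_card_eq_zero hI (hδ.trans_le hGδ)]
    rfl
  | succ n ih =>
    obtain ⟨r, hr, hr'⟩ := ih (half_pos hε) (half_pos hε)
    obtain ⟨s, hs, hs'⟩ := ih (half_pos hδ) (half_pos hδ)
    obtain ⟨ρ, hρ, hρ'⟩ := ih hr hs
    refine ⟨ρ * (ε / 2 * (δ / 2)), by positivity, fun A _ _ B C _ _ I F G hI hF hG hFε hGδ => ?_⟩
    classical
    obtain ⟨i, hi⟩ := card_pos.1 (by omega : 0 < #I)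
    obtain ⟨X, hX, hXF⟩ := exists_dense_slices hε.le hFε i
    obtain ⟨Y, hY, hYG⟩ := exists_dense_slices hδ.le hGδ i
    obtain ⟨Z, hZ, hZ'⟩ := exists_difference_sets X Y
    have hn : #(I.erase i) = n := by rw [card_erase_of_mem hi, hI, Nat.add_sub_cancel]
    have hA : (0 : ℝ) < Fintype.card (A i) := by exact_mod_cast Fintype.card_pos
    rw [zeroDens_update i]
    refine le_expect_of_le_on (fun a => zeroDens_nonneg _) hρ.le (Z := Z) ?_ fun a ha => ?_
    · have : (ε / 2 * Fintype.card (A i)) * (δ / 2 * Fintype.card (A i)) ≤ #X * #Y :=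
        mul_le_mul hX hY (by positivity) (by positivity)
      refine le_of_mul_le_mul_left ?_ hA
      linarith
    · refine hρ' A B C _ _ _ hn (hF.update_const i a) (hG.update_const i a) ?_ ?_
      · obtain ⟨x, hx, x', hx', rfl⟩ := (hZ' a ha).1
        refine (hr' A B B _ _ _ hn (hF.update_const i x) (hF.update_const i x') (hXF x hx)
          (hXF x' hx')).trans (zeroDens_mono fun z hz => ?_)
        rw [Prod.mk_eq_zero] at hz
        rw [hF.map_update_sub hi, hz.1, hz.2, sub_zero]
      · obtain ⟨x, hx, x', hx', rfl⟩ := (hZ' a ha).2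
        refine (hs' A C C _ _ _ hn (hG.update_const i x) (hG.update_const i x') (hYG x hx)
          (hYG x' hx')).trans (zeroDens_mono fun z hz => ?_)
        rw [Prod.mk_eq_zero] at hz
        rw [hG.map_update_sub hi, hz.1, hz.2, sub_zero]

lemma exists_le_zeroDens_sum (ι : Type) [Fintype ι] [DecidableEq ι] (N : ℕ) {δ : ℝ}
    (hδ : 0 < δ) :
    ∃ ρ : ℝ, 0 < ρ ∧ ∀ (A : ι → Type) [∀ i, AddCommGroup (A i)] [∀ i, Fintype (A i)]
      (B : Type) [AddCommGroup B] (T : List ((∀ i, A i) → B)), T.length ≤ N →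
      (∀ F ∈ T, MultiaddOn univ F ∧ δ ≤ zeroDens F) →
      MultiaddOn univ (fun x => (T.map fun F => F x).sum) ∧
        ρ ≤ zeroDens fun x => (T.map fun F => F x).sum := by
  induction N with
  | zero =>
    refine ⟨1, one_pos, fun A _ _ B _ T hT hTδ => ?_⟩
    obtain rfl : T = [] := by simpa using hT
    exact ⟨by simpa using MultiaddOn.zero, by rw [zeroDens_eq_one]; simp⟩
  | succ N ih =>
    obtain ⟨ρ, hρ, h⟩ := ih
    obtain ⟨ρ', hρ', h'⟩ := exists_le_zeroDens_prod ι (Fintype.card ι) hδ hρ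
    refine ⟨min 1 ρ', by positivity, fun A _ _ B _ T hT hTδ => ?_⟩
    rcases T with _ | ⟨F, T⟩
    · exact ⟨by simpa using MultiaddOn.zero, by rw [zeroDens_eq_one] <;> simp⟩
    obtain ⟨⟨hF, hFδ⟩, hTδ⟩ := List.forall_mem_cons.1 hTδ
    obtain ⟨h1, h2⟩ := h A B T (by simpa using hT) hTδ
    simp only [List.map_cons, List.sum_cons]
    refine ⟨hF.add h1, (min_le_right _ _).trans ((h' A B B univ F _ card_univ hF h1 hFδ h2).trans
      (zeroDens_mono fun x hx => ?_))⟩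
    rw [Prod.mk_eq_zero] at hx
    rw [hx.1, hx.2, add_zero]

end Dense

section Piece

lemma zsmul_congr {B : Type} [AddCommGroup B] {q : ℕ} {b : B} (hb : q • b = 0) {z w : ℤ}
    (h : (z : ZMod q) = w) : z • b = w • b := by
  obtain ⟨c, hc⟩ := (ZMod.intCast_eq_intCast_iff_dvd_sub z w q).1 h
  rw [← sub_eq_zero, ← sub_smul, ← neg_sub w z, hc, neg_smul, mul_comm, mul_smul, natCast_zsmul, hb,
    smul_zero, neg_zero]

variable {ι : Type} [DecidableEq ι] [Fintype ι] {A : ι → Type} [∀ i, AddCommGroup (A i)]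
  {B : Type} [AddCommGroup B] {Q : ℕ}

lemma Piece.multiaddOn (t : Piece A B Q) : MultiaddOn univ t.eval where
  map_update_add i _ x a b := by
    simp only [Piece.eval]
    by_cases hi : i ∈ t.I
    · have h : ∀ a, t.G (update x i a) = t.G x := t.G_multiaddOn.map_update_of_notMem i (by simpa) x
      rw [h, h, h, ← add_smul]
      refine zsmul_congr (t.smul_G x) ?_
      rw [Int.cast_add]
      exact t.g_multiaddOn.map_update_add i hi x a b
    · have h : ∀ a, t.g (update x i a) • t.G (update x i a) = t.g x • t.G (update x i a) := fun a =>
        zsmul_congr (t.smul_G _) (t.g_multiaddOn.map_update_of_notMem i hi x a)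
      rw [h, h, h, ← smul_add, t.G_multiaddOn.map_update_add i (by simpa)]
  map_update_of_notMem i hi := absurd (mem_univ i) hi

lemma Piece.inv_le_zeroDens [∀ i, Fintype (A i)] (t : Piece A B Q) :
    (Q : ℝ)⁻¹ ≤ zeroDens t.eval := by
  obtain ⟨i, hi⟩ := t.nonempty
  have : NeZero t.q := ⟨t.q_pos.ne'⟩
  have hq : (0 : ℝ) < t.q := by exact_mod_cast t.q_pos
  rw [zeroDens, ← expect_update i]
  have h : ∀ x, (Q : ℝ)⁻¹ ≤ zeroDens fun a => t.eval (update x i a) := by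
    intro x
    refine le_trans ?_ ((inv_card_le_zeroDens (t.g_multiaddOn.updateHom hi x)).trans
      (zeroDens_mono fun a ha => ?_))
    · rw [ZMod.card]
      exact inv_anti₀ hq (by exact_mod_cast t.q_le)
    · rw [MultiaddOn.updateHom_apply] at ha
      rw [Piece.eval, zsmul_congr (t.smul_G _) (w := 0) (by simpa using ha), zero_smul]
  refine le_trans ?_ (expect_le_expect fun x _ => h x)
  rw [Fintype.expect_const]

end Piece

section Division

lemma exists_generators (G : Type) [AddCommGroup G] [Finite G] :
    ∃ (J : Type) (_ : Fintype J) (n : J → ℕ) (e : J → G) (c : ∀ j, G →+ ZMod (n j)),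
      (∀ j, NeZero (n j)) ∧ (∀ j, n j • e j = 0) ∧ ∀ a, a = ∑ j, (c j a).val • e j := by
  classical
  obtain ⟨J, _, n, hn, ⟨φ⟩⟩ := AddCommGroup.equiv_directSum_zmod_of_finite' G
  let ψ := φ.trans (DirectSum.addEquivProd fun j => ZMod (n j))
  refine ⟨J, inferInstance, n, fun j => ψ.symm (Pi.single j 1),
    fun j => (Pi.evalAddMonoidHom _ j).comp ψ.toAddMonoidHom, fun j => ⟨(one_pos.trans (hn j)).ne'⟩,
    fun j => ?_, fun a => ?_⟩
  · rw [← map_nsmul, ← Pi.single_smul, nsmul_one, ZMod.natCast_self, Pi.single_zero, map_zero]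
  · refine ψ.injective ?_
    rw [map_sum]
    simp only [map_nsmul, AddEquiv.apply_symm_apply, ← Pi.single_smul, nsmul_one]
    rw [← univ_sum_single (ψ a)]
    refine sum_congr rfl fun j _ => ?_
    have : NeZero (n j) := ⟨(one_pos.trans (hn j)).ne'⟩
    rw [ZMod.natCast_val, ZMod.cast_id', id]
    rfl

variable {ι : Type} [DecidableEq ι] [Fintype ι] {A : ι → Type} [∀ i, AddCommGroup (A i)]
  [∀ i, Finite (A i)] {B : Type} [AddCommGroup B] {I : Finset ι} {p : ℕ}

/-- A multiadditive map that is pointwise divisible by `p`, and vanishes at tuples with a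
`p`-torsion entry, is `p` times a multiadditive map. -/
lemma MultiaddOn.exists_eq_nsmul (hp : p.Prime) {f : (∀ i, A i) → B} (hf : MultiaddOn I f)
    (hfp : ∀ x, ∃ b, f x = p • b) (hf0 : ∀ x, ∀ i ∈ I, p • x i = 0 → f x = 0) :
    ∃ H, MultiaddOn I H ∧ ∀ x, f x = p • H x := by
  induction I using Finset.induction_on generalizing f with
  | empty =>
    obtain ⟨b, hb⟩ := hfp 0
    exact ⟨fun _ => b, ⟨by simp, by simp⟩, fun x => (hf.congr (by simp)).trans hb⟩
  | insert i I hi ih =>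
    obtain ⟨J, _, n, e, c, hn, he, hc⟩ := exists_generators (A i)
    have hI := mem_insert_self i I
    have hfe : ∀ j, MultiaddOn I fun x => f (update x i (e j)) := fun j => by
      simpa [hi] using hf.update_const i (e j)
    have key : ∀ j, ∃ h : (∀ i, A i) → B, MultiaddOn I h ∧
        (∀ x, f (update x i (e j)) = p • h x) ∧ ∀ x, n j • h x = 0 := by
      intro j
      by_cases hpn : p ∣ n j
      · obtain ⟨h, h1, h2⟩ := ih (hfe j) (fun x => hfp _) fun x i' hi' hx =>
          hf0 _ i' (mem_insert_of_mem hi') (by rwa [update_of_ne (ne_of_mem_of_not_mem hi' hi)])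
        refine ⟨h, h1, h2, fun x => ?_⟩
        obtain ⟨m, hm⟩ := hpn
        rw [hm, mul_comm, mul_smul, ← h2, ← hf.map_update_nsmul hI]
        refine hf0 _ i hI ?_
        rw [update_self, ← mul_smul, ← hm, he]
      · have hcop := Nat.gcd_eq_gcd_ab p (n j)
        rw [(Nat.Prime.coprime_iff_not_dvd hp).2 hpn] at hcop
        have hnf : ∀ x, n j • f (update x i (e j)) = 0 := fun x => by
          rw [← hf.map_update_nsmul hI, he, hf.map_update_zero hI]
        refine ⟨fun x => Nat.gcdA p (n j) • f (update x i (e j)),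
          (hfe j).comp_hom (zsmulAddGroupHom _), fun x => ?_, fun x => ?_⟩
        · calc f (update x i (e j)) = (1 : ℤ) • f (update x i (e j)) := (one_smul _ _).symm
            _ = _ := by
              rw [show (1 : ℤ) = _ from hcop, add_smul, mul_comm (n j : ℤ), mul_smul, mul_smul,
                natCast_zsmul, natCast_zsmul, hnf, smul_zero, add_zero]
        · rw [smul_comm, hnf, smul_zero]
    choose h h1 h2 h3 using key
    refine ⟨fun x => ∑ j, ((c j (x i)).val : ℤ) • h j x, MultiaddOn.sum fun j _ => ⟨?_, ?_⟩, ?_⟩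
    · intro i' hi' x a b
      rcases eq_or_ne i' i with rfl | hne
      · simp only [update_self, (h1 j).map_update_of_notMem i' hi, ← add_smul]
        refine zsmul_congr (h3 j x) ?_
        have : NeZero (n j) := hn j
        push_cast [ZMod.natCast_zmod_val]
        exact map_add _ _ _
      · simp only [update_of_ne hne.symm, ← smul_add]
        rw [(h1 j).map_update_add i' (mem_of_mem_insert_of_ne hi' hne)]
    · intro i' hi' x a
      rw [mem_insert, not_or] at hi'
      rw [update_of_ne (Ne.symm hi'.1), (h1 j).map_update_of_notMem i' hi'.2]
    · intro x
      rw [smul_sum]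
      simp_rw [smul_comm p, ← h2, natCast_zsmul, ← hf.map_update_nsmul hI]
      rw [← hf.map_update_sum hI, ← hc, update_eq_self]

end Division

section Descent

variable {ι : Type} [DecidableEq ι] [Fintype ι] {A A' : ι → Type} [∀ i, AddCommGroup (A i)]
  [∀ i, AddCommGroup (A' i)] {B B' : Type} [AddCommGroup B] [AddCommGroup B'] {I : Finset ι}

lemma map_update_hom (π : ∀ i, A i →+ A' i) (x : ∀ i, A i) (i : ι) (a : A i) :
    (fun j => π j (update x i a j)) = update (fun j => π j (x j)) i (π i a) :=
  funext fun j => apply_update (fun j => π j) x i a j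

lemma MultiaddOn.comp_pi {F : (∀ i, A' i) → B} (hF : MultiaddOn I F) (π : ∀ i, A i →+ A' i) :
    MultiaddOn I fun x : ∀ i, A i => F fun i => π i (x i) where
  map_update_add i hi x a b := by
    simp only [map_update_hom, map_add]
    exact hF.map_update_add i hi _ _ _
  map_update_of_notMem i hi x a := by
    simp only [map_update_hom]
    exact hF.map_update_of_notMem i hi _ _

lemma MultiaddOn.exists_descent {F : (∀ i, A i) → B} (hF : MultiaddOn univ F)
    (π : ∀ i, A i →+ A' i) (hπ : ∀ i, Surjective (π i)) (h0 : ∀ x i, π i (x i) = 0 → F x = 0) :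
    ∃ F' : (∀ i, A' i) → B, MultiaddOn univ F' ∧ ∀ x, F x = F' fun i => π i (x i) := by
  have h1 : ∀ (x : ∀ i, A i) i a b, π i a = π i b → F (update x i a) = F (update x i b) := by
    intro x i a b h
    rw [← sub_eq_zero, ← hF.map_update_sub (mem_univ i)]
    exact h0 _ i (by rw [update_self, map_sub, h, sub_self])
  have h2 : ∀ x y : ∀ i, A i, (∀ i, π i (x i) = π i (y i)) → F x = F y := by
    intro x y h
    have key : ∀ S : Finset ι, F (S.piecewise x y) = F y := by
      intro S
      induction S using Finset.induction_on with
      | empty => rw [piecewise_empty]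
      | insert i S hi ih =>
        rw [piecewise_insert, h1 _ i _ _ (h i), ← ih]
        congr 1
        rw [update_eq_iff]
        simp [hi]
    rw [← key univ, piecewise_univ]
  let s : (∀ i, A' i) → ∀ i, A i := fun y i => surjInv (hπ i) (y i)
  have hs : ∀ y i, π i (s y i) = y i := fun y i => surjInv_eq (hπ i) (y i)
  have h3 : ∀ (y : ∀ i, A' i) i a, F (s (update y i a)) =
      F (update (s y) i (surjInv (hπ i) a)) := by
    intro y i a
    refine h2 _ _ fun j => ?_
    have := congrFun (map_update_hom π (s y) i (surjInv (hπ i) a)) j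
    simp only [hs, surjInv_eq] at this
    rw [hs, this]
  refine ⟨fun y => F (s y), ⟨fun i _ y a b => ?_, fun i hi => absurd (mem_univ i) hi⟩,
    fun x => h2 _ _ fun i => (hs (fun i => π i (x i)) i).symm⟩
  rw [h3, h3, h3, ← hF.map_update_add i (mem_univ i)]
  exact h1 _ _ _ _ (by rw [map_add, surjInv_eq (hπ i), surjInv_eq (hπ i), surjInv_eq (hπ i)])

/-- A piece with another bound on its modulus. -/
def Piece.mono {Q Q' : ℕ} (t : Piece A B Q) (h : Q ≤ Q') : Piece A B Q' where
  __ := t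
  q_le := t.q_le.trans h

lemma HasStructure.mono {N Q Q' : ℕ} {F : (∀ i, A i) → B} (h : HasStructure N Q F) (hQ : Q ≤ Q') :
    HasStructure N Q' F := by
  obtain ⟨T, h1, h2⟩ := h
  refine ⟨T.map fun t => t.mono hQ, by simpa using h1, fun x => ?_⟩
  rw [h2, List.map_map]
  rfl

lemma HasStructure.add {N N' Q : ℕ} {F G : (∀ i, A i) → B} (hF : HasStructure N Q F)
    (hG : HasStructure N' Q G) : HasStructure (N + N') Q fun x => F x + G x := by
  obtain ⟨T, h1, h2⟩ := hF
  obtain ⟨T', h1', h2'⟩ := hG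
  refine ⟨T ++ T', by rw [List.length_append]; exact add_le_add h1 h1', fun x => ?_⟩
  rw [List.map_append, List.sum_append, ← h2, ← h2']

variable [∀ i, Finite (A i)] {p : ℕ}

lemma Piece.exists_lift (hp : p.Prime) {π : ∀ i, A i →+ A' i} (hπ : ∀ i a, p • a = 0 → π i a = 0)
    {f : B' →+ B} (hf : ∀ b, ∃ b', f b = p • b') {Q : ℕ} (t : Piece A' B' Q) :
    ∃ s : Piece A B (p * Q), ∀ x, p • s.eval x = f (t.eval fun i => π i (x i)) := by
  have hg := t.g_multiaddOn.comp_pi π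
  have hG := (t.G_multiaddOn.comp_pi π).comp_hom f
  have hcast : ∀ z w : ℤ, ((p * z : ℤ) : ZMod (p * t.q)) = (p * w : ℤ) ↔ (z : ZMod t.q) = w := by
    intro z w
    rw [ZMod.intCast_eq_intCast_iff_dvd_sub, ZMod.intCast_eq_intCast_iff_dvd_sub, ← mul_sub,
      Nat.cast_mul, mul_dvd_mul_iff_left (by exact_mod_cast hp.ne_zero)]
  have hpq : 0 < p * t.q := Nat.mul_pos hp.pos t.q_pos
  have : NeZero (p * t.q) := ⟨hpq.ne'⟩
  have h : MultiaddOn t.I fun x : ∀ i, A i =>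
      ((p * t.g fun i => π i (x i) : ℤ) : ZMod (p * t.q)) := by
    constructor
    · intro i hi x a b
      rw [← Int.cast_add, ← mul_add, hcast, Int.cast_add]
      exact hg.map_update_add i hi x a b
    · intro i hi x a
      rw [hcast]
      exact hg.map_update_of_notMem i hi x a
  obtain ⟨g, hg1, hg2⟩ := h.exists_eq_nsmul hp (fun x => ⟨(t.g fun i => π i (x i) : ℤ), by simp⟩)
    fun x i hi hx => by
      rw [(hcast _ 0).2, mul_zero, Int.cast_zero]
      rw [Int.cast_zero]
      exact t.g_multiaddOn.map_eq_zero hi (hπ i _ hx)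
  obtain ⟨G, hG1, hG2⟩ := hG.exists_eq_nsmul hp (fun x => hf _)
    fun x i hi hx => by rw [t.G_multiaddOn.map_eq_zero hi (hπ i _ hx), map_zero]
  refine ⟨⟨t.I, t.nonempty, p * t.q, hpq, Nat.mul_le_mul_left p t.q_le, fun x => (g x).val,
    by simpa using hg1, G, hG1, fun x => ?_⟩, fun x => ?_⟩
  · rw [mul_comm, mul_smul, ← hG2, ← map_nsmul, t.smul_G, map_zero]
  · rw [Piece.eval, Piece.eval, smul_comm, ← hG2, map_zsmul]
    refine zsmul_congr (q := t.q) (by rw [← map_nsmul, t.smul_G, map_zero]) ((hcast _ _).1 ?_)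
    rw [hg2]
    push_cast
    simp

lemma HasStructure.exists_lift (hp : p.Prime) {π : ∀ i, A i →+ A' i}
    (hπ : ∀ i a, p • a = 0 → π i a = 0) {f : B' →+ B} (hf : ∀ b, ∃ b', f b = p • b') {N Q : ℕ}
    {F : (∀ i, A' i) → B'} (hF : HasStructure N Q F) :
    ∃ T : List (Piece A B (p * Q)), T.length ≤ N ∧
      ∀ x, p • (T.map fun t => t.eval x).sum = f (F fun i => π i (x i)) := by
  obtain ⟨T, h1, h2⟩ := hF
  choose s hs using fun t : Piece A' B' Q => t.exists_lift hp hπ hf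
  refine ⟨T.map s, by simpa using h1, fun x => ?_⟩
  rw [h2, List.smul_sum, map_list_sum, List.map_map, List.map_map, List.map_map]
  congr 1
  exact List.map_congr_left fun t _ => hs t x

end Descent

section Induction

lemma exists_hasStructure_mul (ι : Type) [Fintype ι] [DecidableEq ι] {p M N Q : ℕ} (hp : p.Prime)
    {ε : ℝ} (hε : 0 < ε)
    (h : ∀ (A : ι → Type) [∀ i, AddCommGroup (A i)] [∀ i, Fintype (A i)]
      (B : Type) [AddCommGroup B] [Finite B] (F : (∀ i, A i) → B), MultiaddOn univ F →
      ε ≤ zeroDens F → (∀ x, M • F x = 0) → HasStructure N Q F) :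
    ∃ N' Q', ∀ (A : ι → Type) [∀ i, AddCommGroup (A i)] [∀ i, Fintype (A i)]
      (B : Type) [AddCommGroup B] [Finite B] (F : (∀ i, A i) → B), MultiaddOn univ F →
      ε ≤ zeroDens F → (∀ x, (p * M) • F x = 0) → HasStructure N' Q' F := by
  have hδ : (0 : ℝ) < (↑(p * (Q + 1)) : ℝ)⁻¹ := by
    have := hp.pos
    positivity
  have : Fact p.Prime := ⟨hp⟩
  obtain ⟨ρ₁, hρ₁, h₁⟩ := exists_le_zeroDens_sum ι N hδ
  obtain ⟨ρ₂, hρ₂, h₂⟩ := exists_le_zeroDens_prod ι (Fintype.card ι) hε hρ₁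
  obtain ⟨N₂, h₃⟩ := exists_hasStructure_of_prime ι p hρ₂
  refine ⟨N + N₂, p * (Q + 1), fun A _ _ B _ _ F hF hFε hFM => ?_⟩
  let π : ∀ i, A i →+ (nsmulAddMonoidHom p : A i →+ A i).range := fun i =>
    (nsmulAddMonoidHom p : A i →+ A i).rangeRestrict
  let R : B →+ (nsmulAddMonoidHom p : B →+ B).range :=
    (nsmulAddMonoidHom p : B →+ B).rangeRestrict
  let f := (nsmulAddMonoidHom p : B →+ B).range.subtype
  have hfR : ∀ b, f (R b) = p • b := fun b => rfl
  have hf : Injective f := Subtype.val_injective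
  have hπ : ∀ i, Surjective (π i) := fun i => AddMonoidHom.rangeRestrict_surjective _
  have hπ0 : ∀ i a, π i a = 0 ↔ p • a = 0 := fun i a => Subtype.ext_iff
  have : ∀ i, Fintype (nsmulAddMonoidHom p : A i →+ A i).range := fun i => Fintype.ofFinite _
  obtain ⟨F', hF', hFF'⟩ := (hF.comp_hom R).exists_descent π hπ fun x i hx => hf <| by
    rw [hfR, map_zero, ← hF.map_update_nsmul_self (mem_univ i), (hπ0 i _).1 hx,
      hF.map_update_zero (mem_univ i)]
  have hπs : Surjective (AddMonoidHom.piMap π) := Surjective.piMap hπ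
  have hF'ε : ε ≤ zeroDens F' := by
    refine hFε.trans ((zeroDens_mono (G := fun x => R (F x)) fun x hx => ?_).trans_eq ?_)
    · rw [hx, map_zero]
    · simp only [hFF']
      exact zeroDens_comp_of_surjective (AddMonoidHom.piMap π) hπs F'
  have hF'M : ∀ y, M • F' y = 0 := by
    intro y
    obtain ⟨x, rfl⟩ := hπs y
    refine hf ?_
    rw [map_nsmul, map_zero, ← hFM x, mul_comm, mul_smul, ← hfR, hFF']
    rfl
  obtain ⟨T, hTN, hT⟩ := ((h _ _ F' hF' hF'ε hF'M).mono Q.le_succ).exists_lift hp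
    (fun i a => (hπ0 i a).2) (f := f) fun b => by
      obtain ⟨b', hb'⟩ := b.2
      exact ⟨b', hb'.symm⟩
  obtain ⟨hS, hSρ⟩ := h₁ A B (T.map fun t => t.eval) (by simpa using hTN) (by
    intro G hG
    obtain ⟨t, -, rfl⟩ := List.mem_map.1 hG
    exact ⟨t.multiaddOn, t.inv_le_zeroDens⟩)
  have hFS := (h₃ A B _ (hF.sub hS) ((h₂ A B B univ F _ card_univ hF hS hFε hSρ).trans
    (zeroDens_mono fun x hx => ?_)) fun x => ?_).mono (Nat.le_mul_of_pos_right p Q.succ_pos)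
  · have := HasStructure.add (G := fun x => F x - _) ⟨T, hTN, fun x => rfl⟩ hFS
    simpa [List.map_map, comp_def] using this
  · rw [Prod.mk_eq_zero] at hx
    rw [hx.1, hx.2, sub_zero]
  · rw [smul_sub, List.map_map, sub_eq_zero, ← hfR, hFF']
    exact (hT x).symm

theorem exists_hasStructure_of_nsmul_eq_zero (ι : Type) [Fintype ι] [DecidableEq ι] {ε : ℝ}
    (hε : 0 < ε) (M : ℕ) (hM : M ≠ 0) :
    ∃ N Q, ∀ (A : ι → Type) [∀ i, AddCommGroup (A i)] [∀ i, Fintype (A i)]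
      (B : Type) [AddCommGroup B] [Finite B] (F : (∀ i, A i) → B), MultiaddOn univ F →
      ε ≤ zeroDens F → (∀ x, M • F x = 0) → HasStructure N Q F := by
  induction M using induction_on_primes with
  | zero => exact absurd rfl hM
  | one => exact ⟨0, 0, fun A _ _ B _ _ F _ _ h => ⟨[], le_rfl, fun x => by simpa using h x⟩⟩
  | prime_mul p M hp ih =>
    obtain ⟨N, Q, h⟩ := ih (right_ne_zero_of_mul hM)
    exact exists_hasStructure_mul ι hp hε h

end Induction

section Assembly

variable {ι : Type} [DecidableEq ι] {A : ι → Type} [∀ i, AddCommGroup (A i)]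
  {B : Type} [AddCommGroup B]

lemma multiaddOn_univ [Fintype ι] {F : (∀ i, A i) → B} (hF : IsMultiadditive F) :
    MultiaddOn univ F :=
  ⟨fun i _ => hF i, fun i hi => absurd (mem_univ i) hi⟩

/-- Extension of a partial tuple by zero. -/
def extendZero {I : Finset ι} (y : ∀ i : I, A i) (i : ι) : A i :=
  if h : i ∈ I then y ⟨i, h⟩ else 0

lemma extendZero_apply {I : Finset ι} (x : ∀ i, A i) {i : ι} (hi : i ∈ I) :
    extendZero (fun i : I => x i) i = x i := dif_pos hi

lemma extendZero_update {I : Finset ι} (y : ∀ i : I, A i) (i : I) (a : A i) :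
    extendZero (update y i a) = update (extendZero y) (i : ι) a := by
  funext j
  by_cases hj : (i : ι) = j
  · subst hj
    rw [extendZero, dif_pos i.2, update_self, update_self]
  · rw [update_of_ne (Ne.symm hj), extendZero, extendZero]
    split_ifs with h
    · exact update_of_ne (fun h' => hj (congrArg Subtype.val h').symm) _ _
    · rfl

lemma MultiaddOn.isMultiadditive {I : Finset ι} {F : (∀ i, A i) → B} (hF : MultiaddOn I F) :
    IsMultiadditive fun y : ∀ i : I, A i => F (extendZero y) := fun i y a b => by
  simp only [extendZero_update]
  exact hF.map_update_add i i.2 _ a b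

lemma zeroDens_eq_card_div {X : Type} [Fintype X] (F : X → B) :
    zeroDens F = (Nat.card {x // F x = 0} : ℝ) / Fintype.card X := by
  classical
  rw [zeroDens, Fintype.expect_eq_sum_div_card, sum_boole, Nat.card_eq_fintype_card,
    Fintype.card_subtype]

variable [Fintype ι] {N Q : ℕ}

lemma HasStructure.exists_eq_sum {F : (∀ i, A i) → B} (h : HasStructure N Q F) :
    ∃ (CI : Finset ι → Type) (_ : ∀ I, AddCommGroup (CI I)) (_ : ∀ I, Fintype (CI I))
      (g : ∀ I : Finset ι, (∀ i : I, A i) → CI I)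
      (G : ∀ I : Finset ι, CI I → (∀ i : (Iᶜ : Finset ι), A i) → B),
      (∀ I, Nat.card (CI I) ≤ (Q + 1) ^ N) ∧
      (∀ I, IsMultiadditive (g I)) ∧
      (∀ (I : Finset ι) (c c' : CI I) y, G I (c + c') y = G I c y + G I c' y) ∧
      (∀ (I : Finset ι) (c : CI I), IsMultiadditive (G I c)) ∧
      (∀ x : ∀ i, A i, F x = ∑ I ∈ Finset.filter (fun I => I.Nonempty) Finset.univ,
        G I (g I (fun i => x i)) (fun i => x i)) := by
  obtain ⟨T, hTN, hT⟩ := h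
  have hq : ∀ s, NeZero (T.get s).q := fun s => ⟨(T.get s).q_pos.ne'⟩
  refine ⟨fun I => ∀ s : {s // (T.get s).I = I}, ZMod (T.get s).q, fun I => inferInstance,
    fun I => inferInstance, fun I y s => ((T.get s).g (extendZero y) : ZMod (T.get s).q),
    fun I c y => ∑ s, ((c s).val : ℤ) • (T.get s).G (extendZero y), fun I => ?_, fun I i y a b => ?_,
    fun I c c' y => ?_, fun I c i y a b => ?_, fun x => ?_⟩
  · rw [Nat.card_pi]
    calc ∏ s : {s // (T.get s).I = I}, Nat.card (ZMod (T.get s).q)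
        ≤ ∏ s : {s // (T.get s).I = I}, (Q + 1) := prod_le_prod' fun s _ => by
          rw [Nat.card_zmod]
          exact (T.get s).q_le.trans Q.le_succ
      _ ≤ (Q + 1) ^ N := by
          rw [prod_const, card_univ]
          exact Nat.pow_le_pow_right Q.succ_pos
            ((Fintype.card_subtype_le _).trans (by simpa using hTN))
  · funext ⟨s, hs⟩
    subst hs
    exact (T.get s).g_multiaddOn.isMultiadditive i y a b
  · rw [← sum_add_distrib]
    refine sum_congr rfl fun s _ => ?_
    rw [← add_smul]
    exact zsmul_congr ((T.get s).smul_G _) (by simp)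
  · rw [← sum_add_distrib]
    refine sum_congr rfl fun ⟨s, hs⟩ _ => ?_
    subst hs
    rw [← smul_add]
    exact congrArg _ ((T.get s).G_multiaddOn.isMultiadditive i y a b)
  · have h1 : F x = ∑ s, (T.get s).eval x := by
      rw [hT, ← List.sum_ofFn]
      congr 1
      exact List.ext_get (by simp) (by simp)
    rw [h1, ← sum_fiberwise_of_maps_to (t := univ.filter fun I : Finset ι => I.Nonempty)
      (g := fun s => (T.get s).I) fun s _ => by simpa using (T.get s).nonempty]
    refine sum_congr rfl fun I _ => ?_
    rw [sum_subtype _ (p := fun s => (T.get s).I = I) (by simp)]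
    refine sum_congr rfl fun ⟨s, hs⟩ _ => ?_
    subst hs
    have h2 : (T.get s).G (extendZero fun i : ((T.get s).Iᶜ : Finset ι) => x i) = (T.get s).G x :=
      (T.get s).G_multiaddOn.congr fun i hi => extendZero_apply x hi
    rw [h2]
    refine zsmul_congr ((T.get s).smul_G x) ?_
    rw [Int.cast_natCast, ZMod.natCast_zmod_val]
    exact (T.get s).g_multiaddOn.congr fun i hi => (extendZero_apply x hi).symm

end Assembly

end MultilinearKernel

/-- **Corollary.** For every `k ≥ 2` and `ε > 0` there is `C = C(k, ε)` such that: if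
`F : A_1 × ⋯ × A_{k-1} → B` is a multilinear map of finite abelian groups with
`P(F = 0) ≥ ε`, then `F(x) = Σ_{∅ ≠ I ⊆ [k-1]} G_I(g_I(x_I), x_{[k-1] ∖ I})` for some finite
abelian groups `C_I` with `|C_I| ≤ C` and multilinear maps `g_I : ∏_{i ∈ I} A_i → C_I` and
`G_I : C_I × ∏_{i ∉ I} A_i → B`. -/
theorem multilinear_kernel_structure (k : ℕ) (hk : 2 ≤ k) (ε : ℝ) (hε : 0 < ε) :
    ∃ C : ℕ,
      ∀ (A : Fin (k-1) → Type) [∀ i, AddCommGroup (A i)] [∀ i, Fintype (A i)]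
        (B : Type) [AddCommGroup B] [Fintype B]
        (F : (∀ i, A i) → B), IsMultiadditive F →
        ε ≤ (Nat.card {x : ∀ i, A i // F x = 0} : ℝ) / (Fintype.card (∀ i, A i) : ℝ) →
      ∃ (CI : Finset (Fin (k-1)) → Type)
        (_ : ∀ I, AddCommGroup (CI I)) (_ : ∀ I, Fintype (CI I))
        (g : ∀ I : Finset (Fin (k-1)), (∀ i : I, A i) → CI I)
        (G : ∀ I : Finset (Fin (k-1)), CI I → (∀ i : (Iᶜ : Finset (Fin (k-1))), A i) → B),
        (∀ I, Nat.card (CI I) ≤ C) ∧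
        (∀ I, IsMultiadditive (g I)) ∧
        (∀ (I : Finset (Fin (k-1))) (c c' : CI I) y, G I (c + c') y = G I c y + G I c' y) ∧
        (∀ (I : Finset (Fin (k-1))) (c : CI I), IsMultiadditive (G I c)) ∧
        (∀ x : ∀ i, A i,
          F x = ∑ I ∈ Finset.filter (fun I => I.Nonempty) Finset.univ,
            G I (g I (fun i => x i)) (fun i => x i)) := by
  obtain ⟨M, hM, h₁⟩ := MultilinearKernel.exists_nsmul_eq_zero (Fin (k-1)) (k - 1) hε
  obtain ⟨N, Q, h₂⟩ :=
    MultilinearKernel.exists_hasStructure_of_nsmul_eq_zero (Fin (k-1)) hε M hM.ne'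
  refine ⟨(Q + 1) ^ N, fun A _ _ B _ _ F hF hFε => ?_⟩
  rw [← MultilinearKernel.zeroDens_eq_card_div] at hFε
  have hF' := MultilinearKernel.multiaddOn_univ hF
  exact (h₂ A B F hF' hFε (h₁ A B _ F (by simp) hF' hFε)).exists_eq_sum
end

section
/- Let p be an odd prime and let φ : ℤ/pℤ × ℤ/pℤ × ℤ/pℤ → ℝ/ℤ be the multiaffine map φ(x, y, z) = (xy + xz + yz)/p mod 1. Then bias(φ) = p^{-2} · conj(G(p)), where G(p) = Σ_{x ∈ ℤ/pℤ} e(x²/p) is the quadratic Gauss sum and conj denotes complex conjugation. In particular, since G(p) = √p when p ≡ 1 (mod 4) and G(p) = i√p when p ≡ 3 (mod 4), one has bias(φ) = p^{-3/2} if p ≡ 1 (mod 4) and bias(φ) = −i·p^{-3/2} if p ≡ 3 (mod 4). -/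
open scoped ComplexOrder

section

open Polynomial Finset

theorem sum_eval_eq_neg_coeff {p : ℕ} [Fact p.Prime] (P : (ZMod p)[X])
    (hP : P.natDegree ≤ p - 1) : ∑ x : ZMod p, P.eval x = -P.coeff (p - 1) := by
  have hp := (Fact.out : p.Prime).two_le
  have htop : ∑ x : ZMod p, x ^ (p - 1) = -1 := by
    have h : ∀ x : ZMod p, x ^ (p - 1) = 1 - if x = 0 then 1 else 0 := by
      intro x
      split_ifs with hx
      · simp [hx]; omega
      · rw [ZMod.pow_card_sub_one_eq_one hx]; simp
    simp [h]
  simp_rw [eval_eq_sum_range' (Nat.lt_succ_of_le hP)]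
  rw [sum_comm, sum_range_succ, ← mul_sum, htop, sum_eq_zero]
  · simp
  · intro i hi
    rw [← mul_sum, FiniteField.sum_pow_lt_card_sub_one, mul_zero]
    simpa using hi

theorem sum_eval_descPochhammer_sq {p m : ℕ} [Fact p.Prime] (hm : p = 2 * m + 1) :
    ∑ x : ZMod p, (descPochhammer (ZMod p) m).eval (x * x) = -1 := by
  have hmonic : ((descPochhammer (ZMod p) m).comp (X ^ 2)).Monic :=
    (monic_descPochhammer (ZMod p) m).comp (monic_X_pow 2) (by simp)
  have hdeg : ((descPochhammer (ZMod p) m).comp (X ^ 2)).natDegree = p - 1 := by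
    rw [natDegree_comp, descPochhammer_natDegree, natDegree_X_pow]; omega
  have h := sum_eval_eq_neg_coeff _ hdeg.le
  rw [← hdeg, hmonic.coeff_natDegree] at h
  simpa [pow_two] using h

theorem coeff_prod_of_coeff_zero {R : Type*} [CommSemiring R] (f : ℕ → R[X]) (m : ℕ)
    (hf : ∀ k, (f k).coeff 0 = 0) :
    (∏ k ∈ range m, f k).coeff m = ∏ k ∈ range m, (f k).coeff 1 := by
  have h : ∀ k, f k = X * (f k).divX := fun k => by
    conv_lhs => rw [← X_mul_divX_add (f k), hf k, C_0, add_zero]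
  rw [prod_congr rfl fun k _ => h k, prod_mul_distrib, prod_const, card_range]
  simp [coeff_X_pow_mul', coeff_zero_prod, coeff_divX]

theorem coeff_taylor_one_eq_zero {p : ℕ} [Fact p.Prime] {ζ : ℂ} (hζ : IsPrimitiveRoot ζ p)
    {P : ℤ[X]} (hP : aeval ζ P = 0) {i : ℕ} (hi : i < p - 1) :
    (taylor 1 (P.map (Int.castRingHom (ZMod p)))).coeff i = 0 := by
  have hp := (Fact.out : p.Prime)
  obtain ⟨Q, rfl⟩ := minpoly.isIntegrallyClosed_dvd (hζ.isIntegral hp.pos) hP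
  have hc : cyclotomic p (ZMod p) = (X - 1) ^ (p - 1) := by
    simpa using cyclotomic_mul_prime_eq_pow_of_not_dvd (ZMod p) (p := p) (n := 1)
      (by simpa using hp.one_lt.ne')
  rw [← cyclotomic_eq_minpoly hζ hp.pos, Polynomial.map_mul, map_cyclotomic, hc, taylor_mul,
    taylor_pow]
  simp [coeff_X_pow_mul', show ¬p ≤ i + 1 by omega]

theorem coeff_taylor_one_X_pow {R : Type*} [CommRing R] (n i : ℕ) :
    (taylor 1 (X ^ n : R[X])).coeff i = (n.choose i : R) := by
  simp [coeff_X_add_one_pow]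

theorem prod_range_two_mul {M : Type*} [CommMonoid M] (f : ℕ → M) (m : ℕ) :
    ∏ i ∈ range (2 * m), f i = ∏ k ∈ range m, (f (2 * k) * f (2 * k + 1)) := by
  induction m with
  | zero => simp
  | succ m ih =>
    rw [show 2 * (m + 1) = 2 * m + 1 + 1 by ring, prod_range_succ, prod_range_succ, ih,
      prod_range_succ, mul_assoc]

theorem factorial_two_mul_eq_prod_odd (m : ℕ) :
    (2 * m).factorial = 2 ^ m * m.factorial * ∏ k ∈ range m, (2 * k + 1) := by
  induction m with
  | zero => simp
  | succ m ih =>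
    rw [show 2 * (m + 1) = 2 * m + 1 + 1 by ring, Nat.factorial_succ, Nat.factorial_succ, ih,
      Nat.factorial_succ, prod_range_succ]
    ring

theorem taylor_prod {R ι : Type*} [CommSemiring R] (r : R) (s : Finset ι) (f : ι → R[X]) :
    taylor r (∏ i ∈ s, f i) = ∏ i ∈ s, taylor r (f i) :=
  map_prod (taylorAlgHom r) f s

theorem cast_sign_eq_neg_two_pow {p m : ℕ} [Fact p.Prime] (hm : p = 2 * m + 1) {ζ : ℂ}
    (hζ : IsPrimitiveRoot ζ p) (ε : ℤ)
    (h : ∑ x : ZMod p, ζ ^ (x * x).val =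
      ε * ∏ k ∈ range m, (ζ ^ (m * (2 * k + 1)) - ζ ^ ((m + 1) * (2 * k + 1)))) :
    (ε : ZMod p) = (-2) ^ m := by
  have hp := (Fact.out : p.Prime).two_le
  have key := coeff_taylor_one_eq_zero hζ (i := m)
    (P := ∑ x : ZMod p, X ^ (x * x).val -
      C ε * ∏ k ∈ range m, (X ^ (m * (2 * k + 1)) - X ^ ((m + 1) * (2 * k + 1))))
    (by simp [h]) (by omega)
  simp only [Polynomial.map_sub, Polynomial.map_sum, Polynomial.map_mul, Polynomial.map_prod,
    Polynomial.map_pow, map_X, map_C, map_sub, map_sum, taylor_mul, taylor_prod, taylor_C,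
    coeff_C_mul, coeff_sub, finsetSum_coeff] at key
  rw [coeff_prod_of_coeff_zero _ _ fun k => by
    rw [coeff_sub, coeff_taylor_one_X_pow, coeff_taylor_one_X_pow]; simp] at key
  simp only [coeff_sub, coeff_taylor_one_X_pow, Nat.choose_one_right] at key
  have hdesc : (m.factorial : ZMod p) * ∑ x : ZMod p, ((x * x).val.choose m : ZMod p) = -1 := by
    rw [← sum_eval_descPochhammer_sq hm, mul_sum]
    refine sum_congr rfl fun x _ => ?_
    conv_rhs => rw [← ZMod.natCast_zmod_val (x * x), descPochhammer_eval_eq_descFactorial,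
      Nat.descFactorial_eq_factorial_mul_choose, Nat.cast_mul]
  have hprod : ∏ k ∈ range m, (((m * (2 * k + 1) : ℕ) : ZMod p) - ((m + 1) * (2 * k + 1) : ℕ)) =
      (-1) ^ m * ∏ k ∈ range m, ((2 * k + 1 : ℕ) : ZMod p) := by
    rw [← card_range m, ← prod_const, card_range, ← prod_mul_distrib]
    refine prod_congr rfl fun k _ => ?_
    push_cast
    ring
  have hw : (2 : ZMod p) ^ m * m.factorial * ∏ k ∈ range m, ((2 * k + 1 : ℕ) : ZMod p) = -1 := by
    rw [← ZMod.wilsons_lemma p, show p - 1 = 2 * m by omega, factorial_two_mul_eq_prod_odd]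
    push_cast
    rfl
  rw [hprod, sub_eq_zero, eq_intCast] at key
  rw [key] at hdesc
  have hone : ((-1 : ZMod p) ^ m) * (-1) ^ m = 1 := by rw [← mul_pow]; simp
  rw [neg_pow]
  linear_combination (-(-1) ^ m * 2 ^ m : ZMod p) * hdesc
    + (ε : ZMod p) * hw * ((-1) ^ m * (-1) ^ m) - (ε : ZMod p) * hone

open Complex in
theorem exp_two_pi_pow_sub_pow {p m : ℕ} (hm : p = 2 * m + 1) (k : ℕ) :
    exp (2 * Real.pi * I / p) ^ (m * (2 * k + 1)) -
      exp (2 * Real.pi * I / p) ^ ((m + 1) * (2 * k + 1)) =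
    I * ((2 * Real.sin (Real.pi * (2 * k + 1) / p) : ℝ) : ℂ) := by
  have hp : (p : ℂ) ≠ 0 := by rw [Nat.cast_ne_zero]; omega
  have hm' : (p : ℂ) = 2 * m + 1 := by rw [hm]; push_cast; ring
  have h1 : exp (2 * Real.pi * I / p) ^ m = -exp (-(Real.pi / p * I)) := by
    rw [← exp_nat_mul, ← neg_one_mul, ← exp_pi_mul_I, ← exp_add]
    congr 1
    field_simp
    rw [hm']
    ring
  have h2 : exp (2 * Real.pi * I / p) ^ (m + 1) = -exp (Real.pi / p * I) := by
    rw [← exp_nat_mul, ← neg_one_mul, ← exp_pi_mul_I, ← exp_add]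
    congr 1
    field_simp
    push_cast
    rw [hm']
    ring
  rw [pow_mul, pow_mul, h1, h2, (odd_two_mul_add_one k).neg_pow, (odd_two_mul_add_one k).neg_pow,
    ← exp_nat_mul, ← exp_nat_mul]
  push_cast
  rw [Complex.sin]
  rw [show (2 * (k : ℂ) + 1) * -(Real.pi / p * I) = -(Real.pi * (2 * k + 1) / p) * I by ring,
    show (2 * (k : ℂ) + 1) * (Real.pi / p * I) = (Real.pi * (2 * k + 1) / p) * I by ring]
  linear_combination (exp (-(Real.pi * (2 * k + 1) / p) * I)
    - exp ((Real.pi * (2 * k + 1) / p) * I)) * (-I_sq)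

open Complex in
theorem prod_two_sin_sq {p m : ℕ} (hm : p = 2 * m + 1) :
    (∏ k ∈ range m, 2 * Real.sin (Real.pi * (2 * k + 1) / p)) ^ 2 = p := by
  have hp : p ≠ 0 := by omega
  have hpc : (p : ℂ) ≠ 0 := Nat.cast_ne_zero.2 hp
  have hζ := isPrimitiveRoot_exp p hp
  set ζ := exp (2 * Real.pi * I / p) with hζdef
  have h := (show IsPrimitiveRoot ζ (2 * m + 1) from hm ▸ hζ).prod_one_sub_pow_eq_order
  rw [prod_range_two_mul, prod_mul_distrib,
    ← prod_range_reflect (fun k => 1 - ζ ^ (2 * k + 1 + 1)), ← prod_mul_distrib] at h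
  have hterm : ∀ k ∈ range m, (1 - ζ ^ (2 * k + 1)) * (1 - ζ ^ (2 * (m - 1 - k) + 1 + 1)) =
      (((2 * Real.sin (Real.pi * (2 * k + 1) / p)) ^ 2 : ℝ) : ℂ) := by
    intro k hk
    have hk := mem_range.1 hk
    set u := exp (Real.pi * (2 * k + 1) / p * I) with hu
    set v := exp (-(Real.pi * (2 * k + 1) / p) * I) with hv
    have huv : u * v = 1 := by
      rw [hu, hv, ← exp_add]
      simp
    have h1 : ζ ^ (2 * k + 1) = u ^ 2 := by
      rw [hζdef, ← exp_nat_mul, hu, ← exp_nat_mul]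
      congr 1
      push_cast
      ring
    have h2 : ζ ^ (2 * (m - 1 - k) + 1 + 1) = v ^ 2 := by
      have h3 : ζ ^ (2 * (m - 1 - k) + 1 + 1) * ζ ^ (2 * k + 1) = 1 := by
        rw [← pow_add, show 2 * (m - 1 - k) + 1 + 1 + (2 * k + 1) = p by omega, hζ.pow_eq_one]
      rw [h1] at h3
      linear_combination v ^ 2 * h3 - ζ ^ (2 * (m - 1 - k) + 1 + 1) * (u * v + 1) * huv
    rw [h1, h2]
    push_cast
    rw [Complex.sin, ← hu, ← hv]
    linear_combination (v - u) ^ 2 * (-I_sq) + (u * v - 1) * huv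
  rw [prod_congr rfl hterm, ← ofReal_prod, prod_pow] at h
  rw [hm] at h ⊢
  exact_mod_cast h

open Complex in
theorem prod_exp_sub_exp {p m : ℕ} (hm : p = 2 * m + 1) :
    ∏ k ∈ range m, (exp (2 * Real.pi * I / p) ^ (m * (2 * k + 1)) -
      exp (2 * Real.pi * I / p) ^ ((m + 1) * (2 * k + 1))) = I ^ m * (Real.sqrt p : ℂ) := by
  have hsqrt : Real.sqrt p = ∏ k ∈ range m, 2 * Real.sin (Real.pi * (2 * k + 1) / p) := by
    rw [Real.sqrt_eq_iff_eq_sq p.cast_nonneg, prod_two_sin_sq hm]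
    refine prod_nonneg fun k hk => mul_nonneg zero_le_two (Real.sin_nonneg_of_nonneg_of_le_pi
      (by positivity) ?_)
    have hk : 2 * k + 1 ≤ p := by have := mem_range.1 hk; omega
    have hp : (0 : ℝ) < p := by rw [Nat.cast_pos]; omega
    rw [div_le_iff₀ hp]
    gcongr
    exact_mod_cast hk
  rw [prod_congr rfl fun k _ => exp_two_pi_pow_sub_pow hm k, prod_mul_distrib, prod_const,
    card_range, ← ofReal_prod, hsqrt]

theorem sum_comp_sq_eq_gaussSum {F : Type*} [Field F] [Fintype F] [DecidableEq F]
    (hF : ringChar F ≠ 2) {ψ : AddChar F ℂ} (hψ : ψ.IsPrimitive) :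
    ∑ x : F, ψ (x * x) = gaussSum ((quadraticChar F).ringHomComp (Int.castRingHom ℂ)) ψ := by
  have h0 : ∑ a : F, ψ a = 0 := by
    have := AddChar.sum_mulShift (1 : F) hψ
    simpa using this
  rw [← sum_fiberwise (s := univ) (g := fun x : F => x ^ 2)]
  have h1 : ∀ a : F, ∑ x with x ^ 2 = a, ψ (x * x) = (quadraticChar F a : ℂ) * ψ a + ψ a := by
    intro a
    rw [sum_congr rfl (g := fun _ => ψ a) fun x hx => by rw [← (mem_filter.1 hx).2, pow_two]]
    have := quadraticChar_card_sqrts hF a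
    rw [Set.toFinset_ofPred] at this
    rw [sum_const, nsmul_eq_mul, ← Int.cast_natCast, this]
    push_cast
    ring
  rw [sum_congr rfl fun a _ => h1 a, sum_add_distrib, h0, add_zero]
  rfl

theorem sum_comp_sq_sq {p m : ℕ} [Fact p.Prime] (hm : p = 2 * m + 1) {ψ : AddChar (ZMod p) ℂ}
    (hψ : ψ.IsPrimitive) : (∑ x : ZMod p, ψ (x * x)) ^ 2 = (-1) ^ m * p := by
  have hF : ringChar (ZMod p) ≠ 2 := by rw [ZMod.ringChar_zmod_n]; omega
  rw [sum_comp_sq_eq_gaussSum hF hψ, gaussSum_sq _ (quadraticChar_isQuadratic _ |>.comp _) hψ]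
  · have := quadraticChar_neg_one hF
    simp [MulChar.ringHomComp_apply, this, ZMod.card, ZMod.χ₄_eq_neg_one_pow (n := p) (by omega),
      show p / 2 = m by omega]
  · exact MulChar.ringHomComp_ne_one_iff Int.cast_injective |>.2 (quadraticChar_ne_one hF)

open Complex in
theorem sum_stdAddChar_sq {p m : ℕ} [Fact p.Prime] (hm : p = 2 * m + 1) :
    ∑ x : ZMod p, ZMod.stdAddChar (x * x) = (ZMod.χ₈' p : ℂ) * I ^ m * Real.sqrt p := by
  have hp2 : p ≠ 2 := by omega
  have hsq : ∀ x : ZMod p, ZMod.stdAddChar x = exp (2 * Real.pi * I / p) ^ x.val := by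
    intro x
    rw [ZMod.stdAddChar_apply, ZMod.toCircle_apply, ← exp_nat_mul]
    congr 1
    ring
  have hG := sum_comp_sq_sq hm (ZMod.isPrimitive_stdAddChar p)
  obtain ⟨ε, hε, hGε⟩ : ∃ ε : ℤ, (ε = 1 ∨ ε = -1) ∧
      ∑ x : ZMod p, ZMod.stdAddChar (x * x) = ε * (I ^ m * (Real.sqrt p : ℂ)) := by
    have hsqrt : ((Real.sqrt p : ℝ) : ℂ) ^ 2 = p := by
      rw [← ofReal_pow, Real.sq_sqrt p.cast_nonneg, ofReal_natCast]
    have : (∑ x : ZMod p, ZMod.stdAddChar (x * x)) ^ 2 = (I ^ m * (Real.sqrt p : ℂ)) ^ 2 := by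
      rw [hG, mul_pow, hsqrt, ← pow_mul, mul_comm m 2, pow_mul, I_sq]
    rcases sq_eq_sq_iff_eq_or_eq_neg.1 this with h | h
    · exact ⟨1, .inl rfl, by simpa using h⟩
    · exact ⟨-1, .inr rfl, by simpa using h⟩
  have hmod : (ε : ZMod p) = (-2) ^ m := by
    refine cast_sign_eq_neg_two_pow hm (isPrimitiveRoot_exp p (by omega)) ε ?_
    rw [prod_exp_sub_exp hm, ← hGε]
    simp_rw [hsq]
  have hleg := legendreSym.eq_pow p (-2)
  rw [show p / 2 = m by omega, Int.cast_neg, Int.cast_ofNat, ← hmod] at hleg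
  have hF : ringChar (ZMod p) ≠ 2 := by rwa [ZMod.ringChar_zmod_n]
  have hχ := legendreSym.eq_one_or_neg_one p (a := -2) (by simpa using Ring.two_ne_zero hF)
  rw [legendreSym.at_neg_two hp2] at hleg hχ
  have hne := Ring.neg_one_ne_one_of_char_ne_two hF
  have hεχ : ε = ZMod.χ₈' p := by
    rcases hε with rfl | rfl <;> rcases hχ with h | h <;> rw [h] at hleg ⊢
    · simp [hne] at hleg
    · simp [hne.symm] at hleg
  rw [hGε, hεχ, mul_assoc]

theorem eChar_val_div {p : ℕ} [NeZero p] (x : ZMod p) :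
    eChar (((x.val : ℝ) / p : ℝ) : AddCircle (1 : ℝ)) = ZMod.stdAddChar x := by
  rw [eChar, AddCircle.toCircle_apply_mk, ZMod.stdAddChar_apply, ZMod.toCircle_eq_circleExp,
    div_one]

theorem sum_comp_mul_add_mul_add_mul {R : Type*} [CommRing R] [Fintype R] {ψ : AddChar R ℂ}
    (hψ : ψ.IsPrimitive) :
    ∑ x : Fin 3 → R, ψ (x 0 * x 1 + x 0 * x 2 + x 1 * x 2) =
      Fintype.card R * (starRingEnd ℂ) (∑ x : R, ψ (x * x)) := by
  classical
  have hinner : ∀ y z : R, ∑ x : R, ψ (x * y + x * z + y * z) =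
      if z = -y then (Fintype.card R : ℂ) * ψ (y * z) else 0 := by
    intro y z
    simp_rw [← mul_add, AddChar.map_add_eq_mul]
    rw [← sum_mul, AddChar.sum_mulShift _ hψ, add_eq_zero_iff_neg_eq, eq_comm (a := -y)]
    split_ifs <;> simp
  have hsplit := (Fin.consEquiv fun _ : Fin 3 => R).sum_comp
    fun x => ψ (x 0 * x 1 + x 0 * x 2 + x 1 * x 2)
  rw [← hsplit, Fintype.sum_prod_type, sum_comm, ← (finTwoArrowEquiv R).symm.sum_comp,
    Fintype.sum_prod_type]
  simp [Fin.consEquiv, finTwoArrowEquiv, hinner, mul_sum, AddChar.map_neg_eq_conj]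

open Complex in
theorem sum_stdAddChar_sq_of_mod_four_eq_one {p : ℕ} [Fact p.Prime] (hp : p % 4 = 1) :
    ∑ x : ZMod p, ZMod.stdAddChar (x * x) = (Real.sqrt p : ℂ) := by
  rw [sum_stdAddChar_sq (m := p / 2) (by omega), ZMod.χ₈'_nat_eq_if_mod_eight]
  rcases (show p % 8 = 1 ∨ p % 8 = 5 by omega) with h | h
  · rw [show p / 2 = 4 * (p / 8) by omega, pow_mul, I_pow_four]
    simp [h, show p % 2 = 1 by omega]
  · rw [show p / 2 = 4 * (p / 8) + 2 by omega, pow_add, pow_mul, I_pow_four, I_sq]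
    simp [h, show p % 2 = 1 by omega]

open Complex in
theorem sum_stdAddChar_sq_of_mod_four_eq_three {p : ℕ} [Fact p.Prime] (hp : p % 4 = 3) :
    ∑ x : ZMod p, ZMod.stdAddChar (x * x) = I * (Real.sqrt p : ℂ) := by
  rw [sum_stdAddChar_sq (m := p / 2) (by omega), ZMod.χ₈'_nat_eq_if_mod_eight]
  rcases (show p % 8 = 3 ∨ p % 8 = 7 by omega) with h | h
  · rw [show p / 2 = 4 * (p / 8) + 1 by omega, pow_add, pow_mul, I_pow_four]
    simp [h, show p % 2 = 1 by omega]
  · rw [show p / 2 = 4 * (p / 8) + 3 by omega, pow_add, pow_mul, I_pow_four, I_pow_three]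
    simp [h, show p % 2 = 1 by omega]

end

/-- **Gauss sum example.** For an odd prime `p`, the multiaffine map
`φ(x, y, z) = (xy + xz + yz)/p mod 1` on `(ℤ/p)³` has bias `p⁻²·conj(G(p))`, where
`G(p) = Σ_{x ∈ ℤ/p} e(x²/p)` is the quadratic Gauss sum; in particular
`bias(φ) = p^{-3/2}` if `p ≡ 1 (mod 4)` and `bias(φ) = -i·p^{-3/2}` if `p ≡ 3 (mod 4)`. -/
theorem bias_gauss_sum (p : ℕ) [Fact p.Prime] (hodd : p ≠ 2) :
    bias (fun x : Fin 3 → ZMod p =>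
        ((((x 0 * x 1 + x 0 * x 2 + x 1 * x 2).val : ℝ) / p : ℝ) : AddCircle (1 : ℝ))) =
      (starRingEnd ℂ) (∑ x : ZMod p, eChar ((((x * x).val : ℝ) / p : ℝ) : AddCircle (1 : ℝ)))
        / (p : ℂ) ^ 2 ∧
    (p % 4 = 1 →
      bias (fun x : Fin 3 → ZMod p =>
          ((((x 0 * x 1 + x 0 * x 2 + x 1 * x 2).val : ℝ) / p : ℝ) : AddCircle (1 : ℝ))) =
        ((1 / (p * Real.sqrt p) : ℝ) : ℂ)) ∧
    (p % 4 = 3 →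
      bias (fun x : Fin 3 → ZMod p =>
          ((((x 0 * x 1 + x 0 * x 2 + x 1 * x 2).val : ℝ) / p : ℝ) : AddCircle (1 : ℝ))) =
        -Complex.I * ((1 / (p * Real.sqrt p) : ℝ) : ℂ)) := by
  have hp : (p : ℂ) ≠ 0 := Nat.cast_ne_zero.2 (Fact.out : p.Prime).ne_zero
  have hsqrt : ((Real.sqrt p : ℝ) : ℂ) ^ 2 = p := by
    rw [← Complex.ofReal_pow, Real.sq_sqrt p.cast_nonneg, Complex.ofReal_natCast]
  have hsqrt0 : ((Real.sqrt p : ℝ) : ℂ) ≠ 0 := by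
    intro h
    rw [h] at hsqrt
    exact hp (by simpa using hsqrt.symm)
  have hbias : bias (fun x : Fin 3 → ZMod p =>
      ((((x 0 * x 1 + x 0 * x 2 + x 1 * x 2).val : ℝ) / p : ℝ) : AddCircle (1 : ℝ))) =
      (starRingEnd ℂ) (∑ x : ZMod p, ZMod.stdAddChar (x * x)) / (p : ℂ) ^ 2 := by
    simp_rw [bias, eChar_val_div]
    rw [sum_comp_mul_add_mul_add_mul (ZMod.isPrimitive_stdAddChar p)]
    simp only [Fintype.card_pi, ZMod.card, Finset.prod_const, Finset.card_univ, Fintype.card_fin,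
      Nat.cast_pow]
    field_simp
  refine ⟨?_, fun h => ?_, fun h => ?_⟩
  · simp_rw [hbias, eChar_val_div]
  · rw [hbias, sum_stdAddChar_sq_of_mod_four_eq_one h, Complex.conj_ofReal]
    push_cast
    field_simp
    rw [hsqrt]
  · rw [hbias, sum_stdAddChar_sq_of_mod_four_eq_three h, map_mul, Complex.conj_I,
      Complex.conj_ofReal]
    push_cast
    field_simp
    rw [hsqrt]
end
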